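/- Let m, n, r be integers with m ≥ n ≥ r ≥ 1. Let μ_T be the measure on the space of m×r real matrices having density T ↦ det(I_m + TTᵀ)^{−(n+r)/2} with respect to Lebesgue measure. Then the pushforward of μ_T under the map σ sending T to the vector of its singular values in decreasing order equals (2^r π^{r(m+r)/2} / (Γ_r[r/2] Γ_r[m/2])) times the measure on ℝ^r with density κ ↦ 1{κ₁ > ⋯ > κ_r > 0} · ∏_{i=1}^{r} κ_i^{m−r}(1+κ_i²)^{−(n+r)/2} · ∏_{i<j}(κ_i² − κ_j²) with respect to Lebesgue measure on ℝ^r. -/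

import Mathlib

open MeasureTheory Matrix
open scoped Real ENNReal

/-- The multivariate gamma function `Γ_p[a] = π^{p(p-1)/4} ∏_{i=1}^p Γ(a - (i-1)/2)`. -/
noncomputable def mvGamma (p : ℕ) (a : ℝ) : ℝ :=
  Real.pi ^ ((p : ℝ) * ((p : ℝ) - 1) / 4) *
    ∏ i ∈ Finset.range p, Real.Gamma (a - (i : ℝ) / 2)

namespace SingularValues

section Secular

variable {n : ℕ}

/-- The characteristic polynomial of `diagonal a + v vᵀ`. -/
noncomputable def secular (a v : Fin n → ℝ) : Polynomial ℝ :=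
  ∏ i, (Polynomial.X - Polynomial.C (a i)) -
    ∑ i, Polynomial.C (v i ^ 2) * ∏ k ∈ Finset.univ.erase i, (Polynomial.X - Polynomial.C (a k))

lemma eval_secular (a v : Fin n → ℝ) (x : ℝ) :
    (secular a v).eval x = ∏ i, (x - a i) -
      ∑ i, v i ^ 2 * ∏ k ∈ Finset.univ.erase i, (x - a k) := by
  simp [secular, Polynomial.eval_finsetSum, Polynomial.eval_prod]

lemma eval_secular_node (a v : Fin n → ℝ) (i : Fin n) :
    (secular a v).eval (a i) = -(v i ^ 2 * ∏ k ∈ Finset.univ.erase i, (a i - a k)) := by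
  rw [eval_secular, Finset.prod_eq_zero (Finset.mem_univ i) (sub_self _), zero_sub,
    Finset.sum_eq_single i]
  · intro j _ hj
    rw [Finset.prod_eq_zero (Finset.mem_erase.2 ⟨hj.symm, Finset.mem_univ i⟩) (sub_self _),
      mul_zero]
  · simp

lemma degree_sum_secular_lt (a v : Fin n → ℝ) :
    (∑ i, Polynomial.C (v i ^ 2) *
      ∏ k ∈ Finset.univ.erase i, (Polynomial.X - Polynomial.C (a k))).degree < (n : WithBot ℕ) := by
  refine Polynomial.mem_degreeLT.1 (Submodule.sum_mem _ fun i _ => Polynomial.mem_degreeLT.2 ?_)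
  rw [← Polynomial.smul_eq_C_mul]
  refine (Polynomial.degree_smul_le _ _).trans_lt ?_
  rw [Polynomial.degree_prod]
  simp only [Polynomial.degree_X_sub_C, Finset.sum_const,
    Finset.card_erase_of_mem (Finset.mem_univ i),
    Finset.card_univ, Fintype.card_fin]
  have : 0 < n := i.pos
  simp only [nsmul_eq_mul, mul_one]
  exact_mod_cast Nat.sub_lt this one_pos

lemma degree_prod_X_sub_C (μ : Fin n → ℝ) :
    (∏ i, (Polynomial.X - Polynomial.C (μ i))).degree = (n : WithBot ℕ) := by
  rw [Polynomial.degree_prod]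
  simp

lemma degree_prod_sub_secular_lt (a v μ : Fin n → ℝ) :
    (∏ i, (Polynomial.X - Polynomial.C (μ i)) - secular a v).degree < (n : WithBot ℕ) := by
  rw [secular, sub_sub_eq_add_sub, add_sub_right_comm]
  refine (Polynomial.degree_add_le _ _).trans_lt (max_lt ?_ (degree_sum_secular_lt a v))
  rw [← degree_prod_X_sub_C μ]
  refine Polynomial.degree_sub_lt_left ?_ ?_ ?_
  · rw [degree_prod_X_sub_C, degree_prod_X_sub_C]
  · exact (Polynomial.monic_prod_X_sub_C μ _).ne_zero
  · rw [(Polynomial.monic_prod_X_sub_C μ _).leadingCoeff,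
      (Polynomial.monic_prod_X_sub_C a _).leadingCoeff]

lemma prod_eq_secular {a v μ b : Fin n → ℝ} (hb : Function.Injective b)
    (h : ∀ i, ∏ j, (b i - μ j) = (secular a v).eval (b i)) :
    ∏ i, (Polynomial.X - Polynomial.C (μ i)) = secular a v := by
  refine Polynomial.eq_of_degree_sub_lt_of_eval_index_eq (s := Finset.univ) (v := b) hb.injOn ?_ ?_
  · simpa using degree_prod_sub_secular_lt a v μ
  · intro i _
    simpa [Polynomial.eval_prod] using h i

/-- A decreasing nonnegative vector is determined by the monic polynomial whose roots are the
squares of its entries. -/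
lemma eq_of_prod_eq {κ κ' : Fin n → ℝ} (h : Antitone κ) (h0 : ∀ i, 0 ≤ κ i)
    (h' : Antitone κ') (h0' : ∀ i, 0 ≤ κ' i)
    (he : ∏ i, (Polynomial.X - Polynomial.C (κ i ^ 2)) =
      ∏ i, (Polynomial.X - Polynomial.C (κ' i ^ 2))) : κ = κ' := by
  have hr := congrArg Polynomial.roots he
  rw [Polynomial.roots_prod _ _ (Polynomial.monic_prod_X_sub_C _ _).ne_zero,
    Polynomial.roots_prod _ _ (Polynomial.monic_prod_X_sub_C _ _).ne_zero] at hr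
  simp only [Polynomial.roots_X_sub_C, Multiset.bind_singleton, Fin.univ_val_map] at hr
  have hs : ∀ {κ : Fin n → ℝ}, Antitone κ → (∀ i, 0 ≤ κ i) → Antitone fun i => κ i ^ 2 :=
    fun h h0 i j hij => pow_le_pow_left₀ (h0 j) (h hij) 2
  have hl := List.Perm.eq_of_sortedGE (hs h h0).sortedGE_ofFn (hs h' h0').sortedGE_ofFn
    (Multiset.coe_eq_coe.1 hr)
  funext i
  have := congrFun (List.ofFn_injective hl) i
  exact (pow_left_inj₀ (h0 i) (h0' i) two_ne_zero).1 this

/-- The vectors `κ` whose squares strictly interlace the nodes `a` from above: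
`κ₁² > a₁ > κ₂² > a₂ > ⋯`. -/
def interlacing (a : Fin n → ℝ) : Set (Fin n → ℝ) :=
  {κ | (∀ i, 0 < κ i) ∧ (∀ i, a i < κ i ^ 2) ∧ ∀ i j, i < j → κ j ^ 2 < a i}

lemma interlacing.strictAnti {a κ : Fin n → ℝ} (h : κ ∈ interlacing a) : StrictAnti κ := by
  intro i j hij
  exact lt_of_pow_lt_pow_left₀ 2 (h.1 i).le ((h.2.2 i j hij).trans (h.2.1 i))

/-- The squared weights `v i ^ 2` for which `diagonal a + v vᵀ` has eigenvalues `κ j ^ 2`. -/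
noncomputable def weightSq (a κ : Fin n → ℝ) (i : Fin n) : ℝ :=
  (∏ j, (κ j ^ 2 - a i)) / ∏ k ∈ Finset.univ.erase i, (a k - a i)

/-- The nonnegative weights `v` for which `diagonal a + v vᵀ` has eigenvalues `κ j ^ 2`. -/
noncomputable def weight (a κ : Fin n → ℝ) (i : Fin n) : ℝ := √(weightSq a κ i)

lemma weightSq_pos {a κ : Fin n → ℝ} (ha : StrictAnti a) (h : κ ∈ interlacing a) (i : Fin n) :
    0 < weightSq a κ i := by
  rw [weightSq, ← Finset.mul_prod_erase _ _ (Finset.mem_univ i), mul_div_assoc,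
    ← Finset.prod_div_distrib]
  refine mul_pos (sub_pos.2 (h.2.1 i)) (Finset.prod_pos fun k hk => ?_)
  rcases lt_or_gt_of_ne (Finset.ne_of_mem_erase hk) with hki | hki
  · exact div_pos (sub_pos.2 ((ha hki).trans (h.2.1 k))) (sub_pos.2 (ha hki))
  · exact div_pos_of_neg_of_neg (sub_neg.2 (h.2.2 _ _ hki)) (sub_neg.2 (ha hki))

lemma weight_sq {a κ : Fin n → ℝ} (ha : StrictAnti a) (h : κ ∈ interlacing a) (i : Fin n) :
    weight a κ i ^ 2 = weightSq a κ i :=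
  Real.sq_sqrt (weightSq_pos ha h i).le

lemma weight_pos {a κ : Fin n → ℝ} (ha : StrictAnti a) (h : κ ∈ interlacing a) (i : Fin n) :
    0 < weight a κ i :=
  Real.sqrt_pos.2 (weightSq_pos ha h i)

lemma prod_erase_sub_ne_zero {a : Fin n → ℝ} (ha : StrictAnti a) (i : Fin n) :
    ∏ k ∈ Finset.univ.erase i, (a k - a i) ≠ 0 :=
  Finset.prod_ne_zero_iff.2 fun _ hk =>
    sub_ne_zero.2 (ha.injective.ne (Finset.ne_of_mem_erase hk))

lemma prod_sub_node {a : Fin n → ℝ} (ha : StrictAnti a) (κ : Fin n → ℝ) (i : Fin n) :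
    ∏ j, (a i - κ j ^ 2) =
      -(weightSq a κ i * ∏ k ∈ Finset.univ.erase i, (a i - a k)) := by
  have h1 : ∏ j, (a i - κ j ^ 2) = (-1) ^ n * ∏ j, (κ j ^ 2 - a i) := by
    simp_rw [← neg_sub (_ ^ 2) (a i)]
    rw [Finset.prod_neg]; simp
  have h2 : ∏ k ∈ Finset.univ.erase i, (a i - a k) =
      (-1) ^ (n - 1) * ∏ k ∈ Finset.univ.erase i, (a k - a i) := by
    simp_rw [← neg_sub (a _) (a i)]
    rw [Finset.prod_neg]; simp
  obtain ⟨N, rfl⟩ : ∃ N, n = N + 1 := ⟨n - 1, by have := i.pos; omega⟩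
  rw [h1, h2, weightSq]
  have := prod_erase_sub_ne_zero ha i
  field_simp
  rw [Nat.add_sub_cancel, pow_succ]
  ring

lemma prod_eq_secular_weight {a κ : Fin n → ℝ} (ha : StrictAnti a) (h : κ ∈ interlacing a) :
    ∏ i, (Polynomial.X - Polynomial.C (κ i ^ 2)) = secular a (weight a κ) :=
  prod_eq_secular ha.injective fun i => by
    rw [prod_sub_node ha, eval_secular_node, weight_sq ha h]

lemma weight_injOn {a : Fin n → ℝ} (ha : StrictAnti a) : Set.InjOn (weight a) (interlacing a) := by
  intro κ h κ' h' he
  refine eq_of_prod_eq (interlacing.strictAnti h).antitone (fun i => (h.1 i).le)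
    (interlacing.strictAnti h').antitone (fun i => (h'.1 i).le) ?_
  rw [prod_eq_secular_weight ha h, prod_eq_secular_weight ha h', he]

lemma eval_secular_zero_neg {N : ℕ} {a v : Fin (N + 1) → ℝ} (ha : StrictAnti a)
    (hv : ∀ i, 0 < v i) : (secular a v).eval (a 0) < 0 := by
  rw [eval_secular_node]
  refine neg_neg_of_pos (mul_pos (pow_pos (hv 0) 2) (Finset.prod_pos fun k hk => ?_))
  exact sub_pos.2 (ha (Fin.pos_of_ne_zero (Finset.ne_of_mem_erase hk)))

lemma eval_secular_mul_neg {N : ℕ} {a v : Fin (N + 1) → ℝ} (ha : StrictAnti a)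
    (hv : ∀ i, 0 < v i) (i : Fin N) :
    (secular a v).eval (a i.castSucc) * (secular a v).eval (a i.succ) < 0 := by
  rw [eval_secular_node, eval_secular_node]
  have hlt : i.castSucc < i.succ := Fin.castSucc_lt_succ
  rw [← Finset.mul_prod_erase (Finset.univ.erase i.castSucc) _
      (Finset.mem_erase.2 ⟨hlt.ne', Finset.mem_univ _⟩),
    ← Finset.mul_prod_erase (Finset.univ.erase i.succ) _
      (Finset.mem_erase.2 ⟨hlt.ne, Finset.mem_univ _⟩), Finset.erase_right_comm]
  have hp : 0 < (∏ k ∈ (Finset.univ.erase i.succ).erase i.castSucc, (a i.castSucc - a k)) *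
      ∏ k ∈ (Finset.univ.erase i.succ).erase i.castSucc, (a i.succ - a k) := by
    rw [← Finset.prod_mul_distrib]
    refine Finset.prod_pos fun k hk => ?_
    simp only [Finset.mem_erase, Finset.mem_univ, and_true] at hk
    rcases lt_or_gt_of_ne hk.1 with hki | hki
    · exact mul_pos_of_neg_of_neg (sub_neg.2 (ha hki)) (sub_neg.2 (ha (hki.trans hlt)))
    · have : i.succ < k := lt_of_le_of_ne (Fin.castSucc_lt_iff_succ_le.1 hki) (Ne.symm hk.2)
      exact mul_pos (sub_pos.2 (ha hki)) (sub_pos.2 (ha this))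
  have h1 : 0 < v i.castSucc ^ 2 * v i.succ ^ 2 := mul_pos (pow_pos (hv _) 2) (pow_pos (hv _) 2)
  have h2 : 0 < (a i.castSucc - a i.succ) ^ 2 := pow_pos (sub_pos.2 (ha hlt)) 2
  have := mul_pos (mul_pos h1 h2) hp
  linarith

lemma exists_root_secular {N : ℕ} {a v : Fin (N + 1) → ℝ} (ha : StrictAnti a)
    (hv : ∀ i, 0 < v i) (i : Fin (N + 1)) :
    ∃ ρ, a i < ρ ∧ (∀ j, j < i → ρ < a j) ∧ (secular a v).eval ρ = 0 := by
  have hc : Continuous fun x => (secular a v).eval x := (secular a v).continuous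
  induction i using Fin.cases with
  | zero =>
    have hdeg : (secular a v).degree = ((N + 1 : ℕ) : WithBot ℕ) := by
      rw [secular, Polynomial.degree_sub_eq_left_of_degree_lt, degree_prod_X_sub_C]
      rw [degree_prod_X_sub_C]; exact degree_sum_secular_lt a v
    have hlead : (secular a v).leadingCoeff = 1 := by
      rw [secular, Polynomial.leadingCoeff_sub_of_degree_lt,
        (Polynomial.monic_prod_X_sub_C a _).leadingCoeff]
      rw [degree_prod_X_sub_C]; exact degree_sum_secular_lt a v
    have ht := (secular a v).tendsto_atTop_of_leadingCoeff_nonneg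
      (by rw [hdeg]; exact_mod_cast N.succ_pos) (by rw [hlead]; exact zero_le_one)
    obtain ⟨y, hy, hay⟩ :=
      ((ht.eventually_gt_atTop 0).and (Filter.eventually_gt_atTop (a 0))).exists
    obtain ⟨ρ, hρ, h0⟩ := intermediate_value_Ioo hay.le hc.continuousOn
      ⟨eval_secular_zero_neg ha hv, hy⟩
    exact ⟨ρ, hρ.1, fun j hj => absurd hj (Fin.not_lt_zero j), h0⟩
  | succ i =>
    have hlt : a i.succ < a i.castSucc := ha Fin.castSucc_lt_succ
    have hm := eval_secular_mul_neg ha hv i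
    have : ∃ ρ ∈ Set.Ioo (a i.succ) (a i.castSucc), (secular a v).eval ρ = 0 := by
      rcases mul_neg_iff.1 hm with ⟨h1, h2⟩ | ⟨h1, h2⟩
      · exact intermediate_value_Ioo hlt.le hc.continuousOn ⟨h2, h1⟩
      · exact intermediate_value_Ioo' hlt.le hc.continuousOn ⟨h1, h2⟩
    obtain ⟨ρ, hρ, h0⟩ := this
    exact ⟨ρ, hρ.1, fun j hj => hρ.2.trans_le (ha.antitone (Fin.le_castSucc_iff.2 hj)), h0⟩

lemma weight_surjOn {a v : Fin n → ℝ} (ha : StrictAnti a) (ha0 : ∀ i, 0 ≤ a i)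
    (hv : ∀ i, 0 < v i) : ∃ κ ∈ interlacing a, weight a κ = v := by
  obtain _ | N := n
  · exact ⟨v, ⟨fun i => i.elim0, fun i => i.elim0, fun i => i.elim0⟩, funext fun i => i.elim0⟩
  choose ρ h1 h2 h3 using exists_root_secular ha hv
  have hρ : ∀ i, 0 < ρ i := fun i => (ha0 i).trans_lt (h1 i)
  have hmem : (fun i => √(ρ i)) ∈ interlacing a := by
    refine ⟨fun i => Real.sqrt_pos.2 (hρ i), fun i => ?_, fun i j hij => ?_⟩
    · rw [Real.sq_sqrt (hρ i).le]; exact h1 i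
    · rw [Real.sq_sqrt (hρ j).le]; exact h2 j i hij
  have hinj : Function.Injective ρ := by
    have : StrictAnti ρ := fun i j hij => (h2 j i hij).trans (h1 i)
    exact this.injective
  have hsec := prod_eq_secular (a := a) (v := v) (μ := ρ) hinj fun i => by
    rw [h3, Finset.prod_eq_zero (Finset.mem_univ i) (sub_self _)]
  refine ⟨_, hmem, funext fun i => ?_⟩
  have e1 := congrArg (Polynomial.eval (a i)) hsec
  have e2 := prod_sub_node ha (fun i => √(ρ i)) i
  simp only [Real.sq_sqrt (hρ _).le] at e2
  rw [eval_secular_node, Polynomial.eval_prod] at e1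
  simp only [Polynomial.eval_sub, Polynomial.eval_X, Polynomial.eval_C] at e1
  rw [e1, neg_inj] at e2
  have hne : ∏ k ∈ Finset.univ.erase i, (a i - a k) ≠ 0 :=
    Finset.prod_ne_zero_iff.2 fun _ hk =>
      sub_ne_zero.2 (ha.injective.ne (Finset.ne_of_mem_erase hk).symm)
  rw [weight, ← mul_right_cancel₀ hne e2, Real.sqrt_sq (hv i).le]

end Secular

section Jacobian

variable {n : ℕ}

lemma abs_prod_prod_erase (a : Fin n → ℝ) :
    |∏ i, ∏ k ∈ Finset.univ.erase i, (a k - a i)| = |(vandermonde a).det| ^ 2 := by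
  have h : ∀ i, Finset.univ.erase i = ({i}ᶜ : Finset (Fin n)) := fun i => by
    ext; simp
  simp_rw [h, Finset.abs_prod]
  rw [← Finset.prod_prod_Ioi_mul_eq_prod_prod_off_diag fun k i => |a k - a i|, det_vandermonde]
  simp_rw [Finset.abs_prod, ← Finset.prod_pow]
  refine Finset.prod_congr rfl fun i _ => Finset.prod_congr rfl fun j _ => ?_
  rw [abs_sub_comm (a i), sq]

lemma abs_det_prod_erase (a μ : Fin n → ℝ) (hμ : Function.Injective μ) :
    |(Matrix.of fun i j => ∏ k ∈ Finset.univ.erase j, (μ k - a i)).det| =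
      |(vandermonde a).det| * |(vandermonde μ).det| := by
  set L : Fin n → Polynomial ℝ := fun j =>
    ∏ k ∈ Finset.univ.erase j, (Polynomial.C (μ k) - Polynomial.X) with hL
  have hdeg : ∀ j, (L j).natDegree < n := fun j => by
    refine (Polynomial.natDegree_prod_le _ _).trans_lt ?_
    refine (Finset.sum_le_card_nsmul _ _ 1 fun k _ => ?_).trans_lt ?_
    · refine (Polynomial.natDegree_sub_le _ _).trans ?_
      simp
    · rw [Finset.card_erase_of_mem (Finset.mem_univ j)]
      have := j.pos
      simp; omega
  have hev : ∀ (b : Fin n → ℝ), (Matrix.of fun i j => ∏ k ∈ Finset.univ.erase j, (μ k - b i)) =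
      vandermonde b * Matrix.of fun (l : Fin n) j => (L j).coeff l := fun b => by
    ext i j
    rw [Matrix.mul_apply]
    have := Polynomial.eval_eq_sum_range' (hdeg j) (b i)
    rw [← Fin.sum_univ_eq_sum_range (fun l => (L j).coeff l * b i ^ l)] at this
    simp only [Matrix.of_apply, vandermonde_apply]
    simp_rw [mul_comm (b i ^ _)]
    rw [← this]
    simp [hL, Polynomial.eval_prod]
  have hdiag : (Matrix.of fun i j => ∏ k ∈ Finset.univ.erase j, (μ k - μ i)) =
      Matrix.diagonal fun i => ∏ k ∈ Finset.univ.erase i, (μ k - μ i) := by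
    ext i j
    rcases eq_or_ne i j with rfl | hij
    · simp
    · rw [Matrix.diagonal_apply_ne _ hij, Matrix.of_apply]
      exact Finset.prod_eq_zero (Finset.mem_erase.2 ⟨hij, Finset.mem_univ i⟩) (sub_self _)
  have h1 := congrArg (fun M => |M.det|) (hev μ)
  simp only [hdiag, det_diagonal, det_mul, abs_mul] at h1
  rw [abs_prod_prod_erase, sq] at h1
  have hne : |(vandermonde μ).det| ≠ 0 := abs_ne_zero.2 (det_vandermonde_ne_zero_iff.2 hμ)
  rw [hev a, det_mul, abs_mul, ← mul_left_cancel₀ hne h1]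

/-- The Jacobian matrix of `weight a`. -/
noncomputable def weightJacobian (a κ : Fin n → ℝ) : Matrix (Fin n) (Fin n) ℝ :=
  Matrix.of fun i j => weight a κ i * κ j / (κ j ^ 2 - a i)

lemma sub_ne_zero_of_mem {a κ : Fin n → ℝ} (ha : StrictAnti a) (h : κ ∈ interlacing a)
    (i j : Fin n) : κ j ^ 2 - a i ≠ 0 := by
  rcases le_or_gt j i with hji | hij
  · exact sub_ne_zero.2 ((ha.antitone hji).trans_lt (h.2.1 j)).ne'
  · exact sub_ne_zero.2 (h.2.2 i j hij).ne

lemma hasFDerivAt_weight {a κ : Fin n → ℝ} (ha : StrictAnti a) (h : κ ∈ interlacing a) :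
    HasFDerivAt (weight a) (Matrix.toLin' (weightJacobian a κ)).toContinuousLinearMap κ := by
  rw [hasFDerivAt_pi']
  intro i
  have hpos := weightSq_pos ha h i
  have h1 : ∀ j ∈ Finset.univ, HasFDerivAt (fun x : Fin n → ℝ => x j ^ 2 - a i)
      ((2 * κ j) • ContinuousLinearMap.proj (R := ℝ) (φ := fun _ : Fin n => ℝ) j) κ := fun j _ => by
    have := ((hasFDerivAt_apply (𝕜 := ℝ) j κ).pow 2).sub_const (a i)
    simpa using this
  have h2 := ((HasFDerivAt.finsetProd h1).mul_const
    (∏ k ∈ Finset.univ.erase i, (a k - a i))⁻¹).sqrt (by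
      simpa only [weightSq, div_eq_mul_inv] using hpos.ne')
  refine h2.congr_fderiv ?_
  ext x
  have hw : (∏ j, (κ j ^ 2 - a i)) * (∏ k ∈ Finset.univ.erase i, (a k - a i))⁻¹ =
      weightSq a κ i := (div_eq_mul_inv _ _).symm
  have hs : √(weightSq a κ i) = weight a κ i := rfl
  simp only [hw, hs, _root_.smul_apply, _root_.sum_apply,
    ContinuousLinearMap.proj_apply, ContinuousLinearMap.comp_apply, smul_eq_mul,
    LinearMap.coe_toContinuousLinearMap', Matrix.toLin'_apply, Matrix.mulVec, dotProduct,
    weightJacobian, Matrix.of_apply, Finset.mul_sum]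
  refine Finset.sum_congr rfl fun j _ => ?_
  have hw0 := (weight_pos ha h i).ne'
  have hj := sub_ne_zero_of_mem ha h i j
  have he : (∏ k ∈ Finset.univ.erase j, (κ k ^ 2 - a i)) =
      (∏ j, (κ j ^ 2 - a i)) / (κ j ^ 2 - a i) := by
    rw [← Finset.mul_prod_erase _ _ (Finset.mem_univ j), mul_div_cancel_left₀ _ hj]
  have hp := prod_erase_sub_ne_zero ha i
  have hF : (∏ j, (κ j ^ 2 - a i)) =
      weight a κ i ^ 2 * ∏ k ∈ Finset.univ.erase i, (a k - a i) := by
    rw [weight_sq ha h, weightSq, div_mul_cancel₀ _ hp]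
  rw [he, hF]
  field_simp

lemma abs_det_weightJacobian {a κ : Fin n → ℝ} (ha : StrictAnti a) (h : κ ∈ interlacing a) :
    |(weightJacobian a κ).det| =
      (∏ j, κ j) * (∏ i, ∏ j ∈ Finset.Ioi i, (κ i ^ 2 - κ j ^ 2)) *
        (√(∏ i, ∏ j, |κ j ^ 2 - a i|))⁻¹ := by
  have hfac : weightJacobian a κ =
      Matrix.diagonal (fun i => weight a κ i * (∏ j, (κ j ^ 2 - a i))⁻¹) *
        (Matrix.of fun i j => ∏ k ∈ Finset.univ.erase j, (κ k ^ 2 - a i)) *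
          Matrix.diagonal κ := by
    ext i j
    rw [Matrix.mul_diagonal, Matrix.diagonal_mul, weightJacobian, Matrix.of_apply, Matrix.of_apply,
      ← Finset.mul_prod_erase _ _ (Finset.mem_univ j)]
    have hj := sub_ne_zero_of_mem ha h i j
    have he : ∏ k ∈ Finset.univ.erase j, (κ k ^ 2 - a i) ≠ 0 :=
      Finset.prod_ne_zero_iff.2 fun k _ => sub_ne_zero_of_mem ha h i k
    field_simp
  have hκ : StrictAnti fun i => κ i ^ 2 := fun i j hij => (h.2.2 i j hij).trans (h.2.1 i)
  have hE := abs_det_prod_erase a (fun i => κ i ^ 2) hκ.injective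
  have hV : |(vandermonde fun i => κ i ^ 2).det| =
      ∏ i, ∏ j ∈ Finset.Ioi i, (κ i ^ 2 - κ j ^ 2) := by
    rw [det_vandermonde, Finset.abs_prod]
    refine Finset.prod_congr rfl fun i _ => ?_
    rw [Finset.abs_prod]
    refine Finset.prod_congr rfl fun j hj => ?_
    rw [abs_sub_comm, abs_of_pos (sub_pos.2 (hκ (Finset.mem_Ioi.1 hj)))]
  have ha0 : |(vandermonde a).det| ≠ 0 :=
    abs_ne_zero.2 (det_vandermonde_ne_zero_iff.2 ha.injective)
  set F := ∏ i, ∏ j, |κ j ^ 2 - a i| with hF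
  have hFpos : 0 < F := Finset.prod_pos fun i _ => Finset.prod_pos fun j _ =>
    abs_pos.2 (sub_ne_zero_of_mem ha h i j)
  have hw : ∏ i, weight a κ i = √F / |(vandermonde a).det| := by
    have h0 : 0 ≤ ∏ i, weight a κ i := Finset.prod_nonneg fun i _ => (weight_pos ha h i).le
    rw [← abs_of_nonneg h0, ← Real.sqrt_sq (abs_nonneg (vandermonde a).det), ← Real.sqrt_div' _
      (by positivity), ← abs_prod_prod_erase, ← Real.sqrt_sq_eq_abs, ← Finset.prod_pow]
    congr 1
    simp_rw [weight_sq ha h]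
    rw [← abs_of_pos (Finset.prod_pos fun i _ => weightSq_pos ha h i), hF]
    simp_rw [weightSq]
    rw [Finset.prod_div_distrib, abs_div]
    simp_rw [Finset.abs_prod]
  have hκ0 : |∏ j, κ j| = ∏ j, κ j := abs_of_pos (Finset.prod_pos fun j _ => h.1 j)
  have hd : |∏ i, (weight a κ i * (∏ j, (κ j ^ 2 - a i))⁻¹)| = (∏ i, weight a κ i) * F⁻¹ := by
    rw [Finset.prod_mul_distrib, abs_mul,
      abs_of_nonneg (Finset.prod_nonneg fun i _ => (weight_pos ha h i).le), Finset.prod_inv_distrib,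
      abs_inv, hF]
    simp_rw [Finset.abs_prod]
  rw [hfac, det_mul, det_mul, det_diagonal, det_diagonal, abs_mul, abs_mul, hE, hV, hκ0, hd, hw]
  have hs : √F ≠ 0 := (Real.sqrt_pos.2 hFpos).ne'
  have hs2 : F = √F * √F := (Real.mul_self_sqrt hFpos.le).symm
  rw [show F⁻¹ = (√F)⁻¹ * (√F)⁻¹ by rw [← mul_inv, ← hs2]]
  field_simp

end Jacobian

section Integrals

variable {n : ℕ}

/-- The Vandermonde product `∏_{i<j} (κᵢ² - κⱼ²)`. -/
noncomputable def sqVandermonde (κ : Fin n → ℝ) : ℝ :=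
  ∏ i, ∏ j ∈ Finset.Ioi i, (κ i ^ 2 - κ j ^ 2)

lemma sqVandermonde_nonneg {κ : Fin n → ℝ} (hκ : Antitone κ) (hκ0 : ∀ i, 0 ≤ κ i) :
    0 ≤ sqVandermonde κ :=
  Finset.prod_nonneg fun _ _ => Finset.prod_nonneg fun j hj => sub_nonneg.2
    (pow_le_pow_left₀ (hκ0 j) (hκ (Finset.mem_Ioi.1 hj).le) 2)

/-- The open positive orthant. -/
def orthant (n : ℕ) : Set (Fin n → ℝ) := {v | ∀ i, 0 < v i}

lemma measurableSet_orthant : MeasurableSet (orthant n) := by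
  unfold orthant
  measurability

lemma measurableSet_interlacing (a : Fin n → ℝ) : MeasurableSet (interlacing a) := by
  unfold interlacing
  measurability

lemma setLIntegral_orthant {a : Fin n → ℝ} (ha : StrictAnti a) (ha0 : ∀ i, 0 ≤ a i)
    (G : (Fin n → ℝ) → ℝ≥0∞) :
    ∫⁻ v in orthant n, G v = ∫⁻ κ in interlacing a,
      ENNReal.ofReal ((∏ j, κ j) * sqVandermonde κ * (√(∏ i, ∏ j, |κ j ^ 2 - a i|))⁻¹) *
        G (weight a κ) := by
  have himg : weight a '' interlacing a = orthant n := by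
    ext v
    constructor
    · rintro ⟨κ, h, rfl⟩ i
      exact weight_pos ha h i
    · exact fun hv => weight_surjOn ha ha0 hv
  rw [← himg, lintegral_image_eq_lintegral_abs_det_fderiv_mul volume (measurableSet_interlacing a)
    (fun κ h => (hasFDerivAt_weight ha h).hasFDerivWithinAt) (weight_injOn ha)]
  refine setLIntegral_congr_fun (measurableSet_interlacing a) fun κ h => ?_
  simp only [ContinuousLinearMap.det, LinearMap.coe_toContinuousLinearMap, LinearMap.det_toLin',
    abs_det_weightJacobian ha h, sqVandermonde]

lemma volume_preimage_abs {s : Set ℝ} (hs : MeasurableSet s) :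
    volume ((fun x : ℝ => |x|) ⁻¹' s) = 2 * volume.restrict (Set.Ioi 0) s := by
  have h1 : (fun x : ℝ => |x|) ⁻¹' s ∩ Set.Ioi 0 = s ∩ Set.Ioi 0 := by
    ext x
    simp only [Set.mem_inter_iff, Set.mem_preimage, Set.mem_Ioi, and_congr_left_iff]
    intro hx
    rw [abs_of_pos hx]
  have h2 : (fun x : ℝ => |x|) ⁻¹' s ∩ Set.Iio 0 = Neg.neg ⁻¹' (s ∩ Set.Ioi 0) := by
    ext x
    simp only [Set.mem_inter_iff, Set.mem_preimage, Set.mem_Ioi, Set.mem_Iio, neg_pos,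
      and_congr_left_iff]
    intro hx
    rw [abs_of_neg hx]
  have h3 : volume ((fun x : ℝ => |x|) ⁻¹' s \ Set.Ioi 0) =
      volume ((fun x : ℝ => |x|) ⁻¹' s ∩ Set.Iio 0) := by
    rw [Set.sdiff_eq, Set.compl_Ioi]
    exact measure_congr ((ae_eq_refl _).inter Iio_ae_eq_Iic.symm)
  rw [← measure_inter_add_sdiff ((fun x : ℝ => |x|) ⁻¹' s) (measurableSet_Ioi (a := (0 : ℝ))),
    h3, h1, h2,
    Measure.measure_preimage_neg, Measure.restrict_apply hs, two_mul]

lemma lintegral_comp_abs {F : (Fin n → ℝ) → ℝ≥0∞} (hF : Measurable F) :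
    ∫⁻ y : Fin n → ℝ, F (fun i => |y i|) = 2 ^ n * ∫⁻ v in orthant n, F v := by
  have hm : Measurable fun (y : Fin n → ℝ) i => |y i| := by fun_prop
  have ho : orthant n = Set.univ.pi fun _ => Set.Ioi 0 := by ext; simp [orthant]
  have h2 : (2 ^ n : ℝ≥0∞) ≠ 0 := by simp
  have h2' : (2 ^ n : ℝ≥0∞) ≠ ∞ := by simp
  have : (volume : Measure (Fin n → ℝ)).restrict (orthant n) =
      (2 ^ n : ℝ≥0∞)⁻¹ • Measure.map (fun (y : Fin n → ℝ) i => |y i|) volume := by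
    rw [ho, volume_pi, Measure.restrict_pi_pi]
    refine Measure.pi_eq fun s hs => ?_
    rw [Measure.smul_apply, Measure.map_apply hm (MeasurableSet.univ_pi hs)]
    have hp : (fun (y : Fin n → ℝ) i => |y i|) ⁻¹' Set.univ.pi s =
        Set.univ.pi fun i => (fun x : ℝ => |x|) ⁻¹' s i := by ext; simp
    rw [hp, Measure.pi_pi]
    simp_rw [volume_preimage_abs (hs _)]
    rw [Finset.prod_mul_distrib, smul_eq_mul, Finset.prod_const, Finset.card_univ,
      Fintype.card_fin, ← mul_assoc, ENNReal.inv_mul_cancel h2 h2', one_mul]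
  rw [this, lintegral_smul_measure, lintegral_map hF hm, smul_eq_mul, ← mul_assoc,
    ENNReal.mul_inv_cancel h2 h2', one_mul]

lemma lintegral_norm_euclidean {k : ℕ} (hk : 1 ≤ k) {f : ℝ → ℝ≥0∞} (hf : Measurable f) :
    ∫⁻ z : Fin k → ℝ, f √(∑ i, z i ^ 2) =
      ENNReal.ofReal (2 * π ^ ((k : ℝ) / 2) / Real.Gamma ((k : ℝ) / 2)) *
        ∫⁻ w in Set.Ioi (0 : ℝ), ENNReal.ofReal (w ^ (k - 1)) * f w := by
  have : Nonempty (Fin k) := ⟨⟨0, hk⟩⟩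
  set E := EuclideanSpace ℝ (Fin k)
  set μ : Measure E := volume
  have h0 : ∫⁻ z : Fin k → ℝ, f √(∑ i, z i ^ 2) = ∫⁻ x : E, f ‖x‖ := by
    rw [← (EuclideanSpace.volume_preserving_symm_measurableEquiv_toLp (Fin k)).symm.lintegral_comp
      (by fun_prop)]
    simp [EuclideanSpace.norm_eq, E]
  have hfin : Module.finrank ℝ E = k := by simp [E]
  have h1 : ∫⁻ x : E, f ‖x‖ = μ.toSphere Set.univ *
      ∫⁻ x : Set.Ioi (0 : ℝ), f x ∂(Measure.volumeIoiPow (k - 1)) := by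
    have hmp := μ.measurePreserving_homeomorphUnitSphereProd
    rw [hfin] at hmp
    calc ∫⁻ x : E, f ‖x‖ = ∫⁻ x : ({(0)}ᶜ : Set E), f ‖x.1‖ ∂(μ.comap (↑)) := by
          rw [lintegral_subtype_comap (measurableSet_singleton _).compl fun x => f ‖x‖,
            restrict_compl_singleton]
      _ = ∫⁻ x, f x.2 ∂μ.toSphere.prod (.volumeIoiPow (k - 1)) := by
          simpa using hmp.lintegral_comp_emb (Homeomorph.measurableEmbedding _)
            (f ∘ Subtype.val ∘ Prod.snd)
      _ = _ := by
          rw [lintegral_prod _ (by fun_prop)]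
          simp [mul_comm]
  rw [h0, h1, Measure.toSphere_apply_univ, hfin, EuclideanSpace.volume_ball, Measure.volumeIoiPow,
    lintegral_withDensity_eq_lintegral_mul _ (by fun_prop) (by fun_prop)]
  congr 1
  · have hk0 : (0 : ℝ) < (k : ℝ) / 2 := by positivity
    rw [← ENNReal.ofReal_natCast, Fintype.card_fin, ENNReal.ofReal_one, one_pow, one_mul,
      ← ENNReal.ofReal_mul (by positivity), Real.Gamma_add_one hk0.ne',
      Real.sqrt_eq_rpow, ← Real.rpow_mul_natCast Real.pi_pos.le]
    congr 1
    have := (Real.Gamma_pos_of_pos hk0).ne'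
    rw [show 1 / 2 * (k : ℝ) = k / 2 by ring]
    field_simp
  · exact lintegral_subtype_comap measurableSet_Ioi fun w => ENNReal.ofReal (w ^ (k - 1)) * f w

lemma lintegral_pow_mul_inv_sqrt {r : ℕ} (hr : 1 ≤ r) :
    ∫⁻ w in Set.Ioi (0 : ℝ), ENNReal.ofReal (w ^ (r - 1)) * ENNReal.ofReal (√(1 - w ^ 2))⁻¹ =
      ENNReal.ofReal (ProbabilityTheory.beta ((r : ℝ) / 2) (1 / 2) / 2) := by
  have hr0 : (0 : ℝ) < (r : ℝ) / 2 := by positivity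
  set B := ProbabilityTheory.beta ((r : ℝ) / 2) (1 / 2) with hB
  have hBpos : 0 < B := ProbabilityTheory.beta_pos hr0 one_half_pos
  have himg : (fun w : ℝ => w ^ 2) '' Set.Ioi 0 = Set.Ioi 0 := by
    ext x
    constructor
    · rintro ⟨w, hw, rfl⟩
      exact pow_pos (Set.mem_Ioi.1 hw) 2
    · exact fun hx => ⟨√x, Real.sqrt_pos.2 hx, Real.sq_sqrt (le_of_lt hx)⟩
  have h1 : ∫⁻ x in Set.Ioi (0 : ℝ), ProbabilityTheory.betaPDF ((r : ℝ) / 2) (1 / 2) x = 1 := by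
    rw [← ProbabilityTheory.lintegral_betaPDF_eq_one hr0 one_half_pos]
    refine setLIntegral_eq_of_support_subset fun x hx => ?_
    by_contra hx0
    refine hx ?_
    simp only [Set.mem_Ioi] at hx0
    simp [ProbabilityTheory.betaPDF, ProbabilityTheory.betaPDFReal, hx0]
  rw [← himg, lintegral_image_eq_lintegral_abs_deriv_mul measurableSet_Ioi
    (fun w _ => (hasDerivAt_pow 2 w).hasDerivWithinAt)
    (fun x hx y hy h => (pow_left_inj₀ (le_of_lt hx) (le_of_lt hy) two_ne_zero).1 h)] at h1
  have h2 : ∀ w ∈ Set.Ioi (0 : ℝ), ENNReal.ofReal |((2 : ℕ) : ℝ) * w ^ (2 - 1)| *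
      ProbabilityTheory.betaPDF ((r : ℝ) / 2) (1 / 2) (w ^ 2) = ENNReal.ofReal (2 / B) *
        (ENNReal.ofReal (w ^ (r - 1)) * ENNReal.ofReal (√(1 - w ^ 2))⁻¹) := by
    intro w hw
    have hw0 : 0 < w := hw
    rw [ProbabilityTheory.betaPDF, ProbabilityTheory.betaPDFReal,
      ← ENNReal.ofReal_mul (abs_nonneg _), ← ENNReal.ofReal_mul (by positivity),
      ← ENNReal.ofReal_mul (by positivity)]
    congr 1
    by_cases hw1 : w ^ 2 < 1
    · rw [if_pos ⟨by positivity, hw1⟩, abs_of_pos (by positivity), ← hB,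
        ← Real.rpow_natCast_mul hw0.le, Real.sqrt_eq_rpow, ← Real.rpow_neg (by linarith),
        ← Real.rpow_natCast w (r - 1), Nat.cast_sub hr, pow_one,
        show ((r : ℝ) - (1 : ℕ)) = ((2 : ℕ) : ℝ) * ((r : ℝ) / 2 - 1) + 1 by push_cast; ring,
        Real.rpow_add_one hw0.ne']
      norm_num
      ring
    · rw [if_neg (fun h => hw1 h.2), Real.sqrt_eq_zero_of_nonpos (by linarith)]
      simp
  rw [setLIntegral_congr_fun measurableSet_Ioi h2, lintegral_const_mul' _ _ (by simp)] at h1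
  rw [← inv_div, ENNReal.ofReal_inv_of_pos (by positivity)]
  exact ENNReal.eq_inv_of_mul_eq_one_left (by rwa [mul_comm])

lemma lintegral_ball_inv_sqrt (r : ℕ) :
    ∫⁻ x : Fin r → ℝ, ENNReal.ofReal (√(1 - ∑ i, x i ^ 2))⁻¹ =
      ENNReal.ofReal (π ^ (((r : ℝ) + 1) / 2) / Real.Gamma (((r : ℝ) + 1) / 2)) := by
  obtain rfl | hr := Nat.eq_zero_or_pos r
  · have h : √π ≠ 0 := (Real.sqrt_pos.2 Real.pi_pos).ne'
    simp [volume_pi, Real.Gamma_one_half_eq, ← Real.sqrt_eq_rpow, div_self h, ← one_div]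
  have hr0 : (0 : ℝ) < (r : ℝ) / 2 := by positivity
  have h1 : ∀ x : Fin r → ℝ, 1 - ∑ i, x i ^ 2 = 1 - √(∑ i, x i ^ 2) ^ 2 := fun x => by
    rw [Real.sq_sqrt (Finset.sum_nonneg fun i _ => sq_nonneg _)]
  simp_rw [h1]
  rw [lintegral_norm_euclidean hr (f := fun w => ENNReal.ofReal (√(1 - w ^ 2))⁻¹) (by fun_prop),
    lintegral_pow_mul_inv_sqrt hr, ← ENNReal.ofReal_mul (by positivity), ProbabilityTheory.beta,
    Real.Gamma_one_half_eq, ← add_div, add_div _ _ (2 : ℝ), Real.rpow_add Real.pi_pos,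
    ← Real.sqrt_eq_rpow]
  have h2 := (Real.Gamma_pos_of_pos hr0).ne'
  congr 1
  field_simp

end Integrals

section DixonAnderson

variable {r : ℕ}

lemma lintegral_eq_lintegral_scale {d : Fin r → ℝ} (hd : ∀ i, 0 < d i)
    {G : (Fin r → ℝ) → ℝ≥0∞} (hG : Measurable G) :
    ∫⁻ y, G y = ENNReal.ofReal (∏ i, d i) * ∫⁻ x : Fin r → ℝ, G (fun i => d i * x i) := by
  have hdet : (Matrix.diagonal d).det = ∏ i, d i := Matrix.det_diagonal
  have hpos : 0 < ∏ i, d i := Finset.prod_pos fun i _ => hd i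
  have h := Real.smul_map_diagonal_volume_pi (D := d) (by rw [hdet]; exact hpos.ne')
  conv_lhs => rw [← h]
  rw [lintegral_smul_measure, lintegral_map hG
    (Matrix.toLin' (Matrix.diagonal d)).continuous_of_finiteDimensional.measurable, hdet,
    abs_of_pos hpos, smul_eq_mul]
  congr 2 with x
  congr 1 with i
  rw [Matrix.toLin'_apply, Matrix.mulVec_diagonal]

/-- The squares of the entries of `c`, followed by a zero. -/
def sqSnoc (c : Fin r → ℝ) : Fin (r + 1) → ℝ := Fin.snoc (fun i => c i ^ 2) 0

@[simp] lemma sqSnoc_castSucc (c : Fin r → ℝ) (i : Fin r) : sqSnoc c i.castSucc = c i ^ 2 :=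
  Fin.snoc_castSucc (α := fun _ => ℝ) 0 (fun i => c i ^ 2) i

@[simp] lemma sqSnoc_last (c : Fin r → ℝ) : sqSnoc c (Fin.last r) = 0 :=
  Fin.snoc_last (α := fun _ => ℝ) 0 fun i => c i ^ 2

lemma mem_interlacing_sqSnoc {κ : Fin (r + 1) → ℝ} (hκ : StrictAnti κ) (hκ0 : ∀ i, 0 < κ i)
    {c : Fin r → ℝ} :
    ((∀ i, 0 < c i) ∧ κ ∈ interlacing (sqSnoc c)) ↔
      c ∈ interlacing (fun i : Fin r => κ i.succ ^ 2) ∧ ∀ i, c i ^ 2 < κ 0 ^ 2 := by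
  have hsq : ∀ i j, i ≤ j → κ j ^ 2 ≤ κ i ^ 2 := fun i j hij =>
    pow_le_pow_left₀ (hκ0 j).le (hκ.antitone hij) 2
  constructor
  · rintro ⟨hc, -, h1, h2⟩
    have h1' : ∀ i, c i ^ 2 < κ i.castSucc ^ 2 := fun i => by simpa using h1 i.castSucc
    refine ⟨⟨hc, fun i => ?_, fun i j hij => ?_⟩, fun i => ?_⟩
    · simpa using h2 i.castSucc i.succ Fin.castSucc_lt_succ
    · exact (h1' j).trans_le (hsq _ _ (Fin.succ_le_castSucc_iff.2 hij))
    · exact (h1' i).trans_le (hsq _ _ (Fin.zero_le _))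
  · rintro ⟨⟨hc, h1, h2⟩, h3⟩
    refine ⟨hc, hκ0, fun i => ?_, fun i j hij => ?_⟩
    · induction i using Fin.lastCases with
      | last => simpa using pow_pos (hκ0 _) 2
      | cast i =>
        rw [sqSnoc_castSucc]
        obtain _ | r := r
        · exact i.elim0
        induction i using Fin.cases with
        | zero => exact h3 0
        | succ i => exact h2 i.castSucc i.succ Fin.castSucc_lt_succ
    · induction i using Fin.lastCases with
      | last => exact absurd hij (Fin.le_last j).not_gt
      | cast i =>
        rw [sqSnoc_castSucc]
        exact (hsq _ _ (Fin.castSucc_lt_iff_succ_le.1 hij)).trans_lt (h1 i)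

lemma prod_sub_sq_eq {κ₀ : ℝ} {b c : Fin r → ℝ} (hb : StrictAnti b) (hc : c ∈ interlacing b)
    (hκ : ∀ i, b i < κ₀ ^ 2) :
    ∏ i, (κ₀ ^ 2 - c i ^ 2) =
      (∏ i, (κ₀ ^ 2 - b i)) * (1 - ∑ i, weight b c i ^ 2 / (κ₀ ^ 2 - b i)) := by
  have h := congrArg (Polynomial.eval (κ₀ ^ 2)) (prod_eq_secular_weight hb hc)
  rw [eval_secular, Polynomial.eval_prod] at h
  simp only [Polynomial.eval_sub, Polynomial.eval_X, Polynomial.eval_C] at h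
  rw [h, mul_sub, mul_one, Finset.mul_sum]
  congr 1
  refine Finset.sum_congr rfl fun i _ => ?_
  have hi := (sub_pos.2 (hκ i)).ne'
  rw [← Finset.mul_prod_erase _ _ (Finset.mem_univ i)]
  field_simp

/-- The Dixon–Anderson integral, in square-root coordinates. -/
lemma lintegral_dixonAnderson {κ : Fin (r + 1) → ℝ} (hκ : StrictAnti κ) (hκ0 : ∀ i, 0 < κ i) :
    ∫⁻ c in {c : Fin r → ℝ | (∀ i, 0 < c i) ∧ κ ∈ interlacing (sqSnoc c)},
      ENNReal.ofReal ((∏ i, c i) * sqVandermonde c * (√(∏ i, ∏ j, |κ j ^ 2 - c i ^ 2|))⁻¹) =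
    ENNReal.ofReal (π ^ (((r : ℝ) + 1) / 2) / Real.Gamma (((r : ℝ) + 1) / 2) / 2 ^ r) := by
  set b : Fin r → ℝ := fun i => κ i.succ ^ 2 with hbdef
  have hb : StrictAnti b := fun i j hij =>
    pow_lt_pow_left₀ (hκ (Fin.succ_lt_succ_iff.2 hij)) (hκ0 _).le two_ne_zero
  have hb0 : ∀ i, 0 ≤ b i := fun i => sq_nonneg _
  have hbκ : ∀ i, b i < κ 0 ^ 2 := fun i =>
    pow_lt_pow_left₀ (hκ (Fin.succ_pos i)) (hκ0 _).le two_ne_zero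
  set d : Fin r → ℝ := fun i => √(κ 0 ^ 2 - b i) with hd
  have hdpos : ∀ i, 0 < d i := fun i => Real.sqrt_pos.2 (sub_pos.2 (hbκ i))
  have hdsq : ∀ i, d i ^ 2 = κ 0 ^ 2 - b i := fun i => Real.sq_sqrt (sub_pos.2 (hbκ i)).le
  have hP : 0 < ∏ i, d i := Finset.prod_pos fun i _ => hdpos i
  set G : (Fin r → ℝ) → ℝ≥0∞ := fun v =>
    ENNReal.ofReal ((∏ i, d i)⁻¹ * (√(1 - ∑ i, (v i / d i) ^ 2))⁻¹) with hG
  have hGm : Measurable G := by fun_prop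
  have h1 : ∫⁻ v in orthant r, G v = ENNReal.ofReal
      (π ^ (((r : ℝ) + 1) / 2) / Real.Gamma (((r : ℝ) + 1) / 2) / 2 ^ r) := by
    have h2 := lintegral_comp_abs hGm
    have h3 : ∀ y : Fin r → ℝ, G (fun i => |y i|) = G y := fun y => by
      simp [hG, div_pow, sq_abs]
    have h4 : ∀ x : Fin r → ℝ, G (fun i => d i * x i) =
        ENNReal.ofReal (∏ i, d i)⁻¹ * ENNReal.ofReal (√(1 - ∑ i, x i ^ 2))⁻¹ := fun x => by
      rw [← ENNReal.ofReal_mul (by positivity)]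
      simp only [hG, mul_div_cancel_left₀ _ (hdpos _).ne']
    simp_rw [h3] at h2
    rw [lintegral_eq_lintegral_scale hdpos hGm] at h2
    simp_rw [h4] at h2
    rw [lintegral_const_mul' _ _ (by simp), lintegral_ball_inv_sqrt, ← mul_assoc,
      ← ENNReal.ofReal_mul hP.le, mul_inv_cancel₀ hP.ne', ENNReal.ofReal_one, one_mul] at h2
    rw [ENNReal.ofReal_div_of_pos (by positivity), h2, mul_comm, ENNReal.ofReal_pow (by norm_num),
      ENNReal.ofReal_ofNat, ENNReal.mul_div_cancel_right (by simp) (by simp)]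
  have hset : {c : Fin r → ℝ | (∀ i, 0 < c i) ∧ κ ∈ interlacing (sqSnoc c)} =
      interlacing b ∩ {c | ∀ i, c i ^ 2 < κ 0 ^ 2} := by
    ext c
    exact mem_interlacing_sqSnoc hκ hκ0
  have hmeas : MeasurableSet {c : Fin r → ℝ | ∀ i, c i ^ 2 < κ 0 ^ 2} := by measurability
  rw [← h1, setLIntegral_orthant hb hb0, hset, ← lintegral_indicator
    ((measurableSet_interlacing b).inter hmeas),
    ← lintegral_indicator (measurableSet_interlacing b)]
  refine lintegral_congr fun c => ?_
  by_cases hc : c ∈ interlacing b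
  swap
  · simp [hc]
  have hq : (∏ i, d i)⁻¹ * (√(1 - ∑ i, (weight b c i / d i) ^ 2))⁻¹ =
      (√(∏ i, (κ 0 ^ 2 - c i ^ 2)))⁻¹ := by
    rw [prod_sub_sq_eq hb hc hbκ, ← mul_inv, Real.sqrt_mul
      (Finset.prod_nonneg fun i _ => (sub_pos.2 (hbκ i)).le)]
    congr 2
    · simp_rw [← hdsq, Finset.prod_pow]
      exact (Real.sqrt_sq hP.le).symm
    · simp_rw [div_pow, hdsq]
  rw [Set.indicator_of_mem hc]
  simp only [hG]
  rw [hq]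
  by_cases hcκ : ∀ i, c i ^ 2 < κ 0 ^ 2
  · have hE0 : 0 ≤ ∏ i, ∏ j, |c j ^ 2 - b i| :=
      Finset.prod_nonneg fun i _ => Finset.prod_nonneg fun j _ => abs_nonneg _
    have hE : ∏ i, ∏ j, |κ j ^ 2 - c i ^ 2| =
        (∏ i, ∏ j, |c j ^ 2 - b i|) * ∏ i, (κ 0 ^ 2 - c i ^ 2) := by
      rw [Finset.prod_comm, Fin.prod_univ_succ, mul_comm]
      congr 1
      · exact Finset.prod_congr rfl fun i _ => Finset.prod_congr rfl fun j _ => abs_sub_comm _ _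
      · exact Finset.prod_congr rfl fun i _ => abs_of_pos (sub_pos.2 (hcκ i))
    have hnn : 0 ≤ (∏ i, c i) * sqVandermonde c * (√(∏ i, ∏ j, |c j ^ 2 - b i|))⁻¹ := by
      have := sqVandermonde_nonneg (interlacing.strictAnti hc).antitone fun i => (hc.1 i).le
      have := Finset.prod_nonneg fun i (_ : i ∈ Finset.univ) => (hc.1 i).le
      positivity
    rw [Set.indicator_of_mem (show c ∈ interlacing b ∩ {c | ∀ i, c i ^ 2 < κ 0 ^ 2} from
      ⟨hc, hcκ⟩), hE, Real.sqrt_mul hE0,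
      mul_inv, ← mul_assoc, ENNReal.ofReal_mul hnn]
  · have h0 : ∏ i, (κ 0 ^ 2 - c i ^ 2) ≤ 0 := by
      obtain _ | r := r
      · exact absurd (fun i => i.elim0) hcκ
      have hs : ∀ i : Fin r, c i.succ ^ 2 < κ 0 ^ 2 := fun i =>
        (hc.2.2 0 i.succ (Fin.succ_pos i)).trans (hbκ 0)
      have h00 : κ 0 ^ 2 ≤ c 0 ^ 2 := by
        by_contra! hlt
        exact hcκ fun i => Fin.cases hlt hs i
      rw [Fin.prod_univ_succ]
      exact mul_nonpos_of_nonpos_of_nonneg (sub_nonpos.2 h00)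
        (Finset.prod_nonneg fun i _ => (sub_pos.2 (hs i)).le)
    rw [Set.indicator_of_notMem (fun h => hcκ h.2), Real.sqrt_eq_zero_of_nonpos h0]
    simp

end DixonAnderson

section SV

variable {m r : ℕ}

lemma exists_orthogonal_diagonal {n : ℕ} {A : Matrix (Fin n) (Fin n) ℝ} (hA : A.PosSemidef) :
    ∃ (κ : Fin n → ℝ) (Q : Matrix (Fin n) (Fin n) ℝ), Antitone κ ∧ (∀ i, 0 ≤ κ i) ∧ Qᵀ * Q = 1 ∧
      A = Q * Matrix.diagonal (fun i => κ i ^ 2) * Qᵀ := by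
  have hH := hA.isHermitian
  have hcard : n = Fintype.card (Fin n) := (Fintype.card_fin n).symm
  set e : Fin n ≃ Fin n := (finCongr hcard).trans (Fintype.equivOfCardEq (Fintype.card_fin _))
    with he
  have hev : ∀ i, hH.eigenvalues (e i) = hH.eigenvalues₀ (Fin.cast hcard i) := fun i => by
    simp [Matrix.IsHermitian.eigenvalues, he]
  have hnn : ∀ i, 0 ≤ hH.eigenvalues (e i) := fun i => hA.eigenvalues_nonneg _
  set U : Matrix (Fin n) (Fin n) ℝ := hH.eigenvectorUnitary.1 with hU
  have hUU : Uᵀ * U = 1 := Unitary.coe_star_mul_self hH.eigenvectorUnitary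
  have hspec : A = U * Matrix.diagonal hH.eigenvalues * Uᵀ := by
    conv_lhs => rw [hH.spectral_theorem]
    rfl
  refine ⟨fun i => √(hH.eigenvalues (e i)), U.submatrix id e, fun i j hij => ?_,
    fun i => Real.sqrt_nonneg _, ?_, ?_⟩
  · refine Real.sqrt_le_sqrt ?_
    rw [hev, hev]
    exact hH.eigenvalues₀_antitone hij
  · rw [Matrix.transpose_submatrix, ← Matrix.submatrix_mul _ _ _ id _ Function.bijective_id, hUU,
      Matrix.submatrix_one_equiv]
  · simp_rw [Real.sq_sqrt (hnn _)]
    have : Matrix.diagonal (fun i => hH.eigenvalues (e i)) =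
        (Matrix.diagonal hH.eigenvalues).submatrix e e :=
      (Matrix.submatrix_diagonal_equiv hH.eigenvalues e).symm
    rw [this, Matrix.submatrix_mul_equiv, Matrix.transpose_submatrix, Matrix.submatrix_mul_equiv,
      Matrix.submatrix_id_id]
    exact hspec

/-- `κ` is the decreasing vector of singular values of `T`. -/
def IsSV (T : Fin m → Fin r → ℝ) (κ : Fin r → ℝ) : Prop :=
  Antitone κ ∧ (∀ i, 0 ≤ κ i) ∧ ((Matrix.of T)ᵀ * Matrix.of T).charpoly =
    ∏ i, (Polynomial.X - Polynomial.C (κ i ^ 2))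

lemma IsSV.unique {T : Fin m → Fin r → ℝ} {κ κ' : Fin r → ℝ} (h : IsSV T κ) (h' : IsSV T κ') :
    κ = κ' :=
  eq_of_prod_eq h.1 h.2.1 h'.1 h'.2.1 (h.2.2.symm.trans h'.2.2)

lemma charpoly_orthogonal_conj {n : ℕ} {Q : Matrix (Fin n) (Fin n) ℝ} (hQ : Qᵀ * Q = 1)
    (d : Fin n → ℝ) : (Q * Matrix.diagonal d * Qᵀ).charpoly =
      ∏ i, (Polynomial.X - Polynomial.C (d i)) := by
  rw [Matrix.charpoly_mul_comm, ← mul_assoc, hQ, one_mul, Matrix.charpoly_diagonal]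

lemma exists_isSV (T : Fin m → Fin r → ℝ) : ∃ κ, IsSV T κ := by
  obtain ⟨κ, Q, h1, h2, h3, h4⟩ :=
    exists_orthogonal_diagonal (Matrix.posSemidef_conjTranspose_mul_self (Matrix.of T))
  refine ⟨κ, h1, h2, ?_⟩
  rw [← Matrix.conjTranspose_eq_transpose_of_trivial, h4, charpoly_orthogonal_conj h3]

/-- The decreasing vector of singular values of `T`. -/
noncomputable def sv (T : Fin m → Fin r → ℝ) : Fin r → ℝ := (exists_isSV T).choose

lemma isSV_sv (T : Fin m → Fin r → ℝ) : IsSV T (sv T) := (exists_isSV T).choose_spec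

lemma IsSV.sv_eq {T : Fin m → Fin r → ℝ} {κ : Fin r → ℝ} (h : IsSV T κ) : sv T = κ :=
  (isSV_sv T).unique h

lemma det_sub_eq_prod_sv (T : Fin m → Fin r → ℝ) (x : ℝ) :
    (Matrix.scalar (Fin r) x - (Matrix.of T)ᵀ * Matrix.of T).det = ∏ i, (x - sv T i ^ 2) := by
  rw [← Matrix.eval_charpoly, (isSV_sv T).2.2, Polynomial.eval_prod]
  simp

lemma sum_sv_sq (T : Fin m → Fin r → ℝ) :
    ∑ i, sv T i ^ 2 = ((Matrix.of T)ᵀ * Matrix.of T).trace := by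
  have hs : ((Matrix.of T)ᵀ * Matrix.of T).charpoly.Splits := by
    rw [(isSV_sv T).2.2]
    exact Polynomial.Splits.prod fun i _ => Polynomial.Splits.X_sub_C _
  rw [Matrix.trace_eq_sum_roots_charpoly_of_splits hs, (isSV_sv T).2.2,
    Polynomial.roots_prod _ _ (Polynomial.monic_prod_X_sub_C _ _).ne_zero]
  simp [-map_pow, Polynomial.roots_X_sub_C, List.sum_ofFn]

lemma continuous_sv : Continuous (sv : (Fin m → Fin r → ℝ) → Fin r → ℝ) := by
  refine continuous_iff_isClosed.2 fun F hF => IsSeqClosed.isClosed fun T T₀ hT hT₀ => ?_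
  have htr : Continuous fun T : Fin m → Fin r → ℝ => ((Matrix.of T)ᵀ * Matrix.of T).trace := by
    simp only [Matrix.trace, Matrix.diag, Matrix.mul_apply, Matrix.transpose_apply,
      Matrix.of_apply]
    fun_prop
  obtain ⟨B, hB⟩ := ((htr.tendsto T₀).comp hT₀).bddAbove_range
  have hbound : ∀ n, sv (T n) ∈ Metric.closedBall (0 : Fin r → ℝ) √B := fun n => by
    rw [mem_closedBall_zero_iff, pi_norm_le_iff_of_nonneg (Real.sqrt_nonneg _)]
    intro i
    rw [Real.norm_eq_abs]
    refine Real.abs_le_sqrt ((Finset.single_le_sum (f := fun i => sv (T n) i ^ 2)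
      (fun j _ => sq_nonneg _) (Finset.mem_univ i)).trans ?_)
    rw [sum_sv_sq]
    exact hB ⟨n, rfl⟩
  obtain ⟨κ, -, φ, hφ, hκ⟩ := tendsto_subseq_of_bounded Metric.isBounded_closedBall hbound
  have hTφ := hT₀.comp hφ.tendsto_atTop
  have hκi : ∀ i, Filter.Tendsto (fun n => sv (T (φ n)) i) Filter.atTop (nhds (κ i)) := fun i =>
    (tendsto_pi_nhds.1 hκ) i
  have hSV : IsSV T₀ κ := by
    refine ⟨fun i j hij => le_of_tendsto_of_tendsto' (hκi j) (hκi i) fun n =>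
      (isSV_sv _).1 hij, fun i => ge_of_tendsto' (hκi i) fun n => (isSV_sv _).2.1 i,
      Polynomial.funext fun x => ?_⟩
    rw [Matrix.eval_charpoly, Polynomial.eval_prod]
    simp only [Polynomial.eval_sub, Polynomial.eval_X, Polynomial.eval_C]
    have hdet : Continuous fun T : Fin m → Fin r → ℝ =>
        (Matrix.scalar (Fin r) x - (Matrix.of T)ᵀ * Matrix.of T).det := by
      refine Continuous.matrix_det (continuous_const.sub ?_)
      refine continuous_matrix fun i j => ?_
      simp only [Matrix.mul_apply, Matrix.transpose_apply, Matrix.of_apply]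
      fun_prop
    refine tendsto_nhds_unique ((hdet.tendsto T₀).comp hTφ) ?_
    simp only [Function.comp_def, det_sub_eq_prod_sv]
    exact tendsto_finsetProd _ fun i _ => tendsto_const_nhds.sub ((hκi i).pow 2)
  rw [Set.mem_preimage, hSV.sv_eq]
  exact hF.mem_of_tendsto hκ (Filter.Eventually.of_forall fun n => hT (φ n))

lemma measurable_sv : Measurable (sv : (Fin m → Fin r → ℝ) → Fin r → ℝ) :=
  continuous_sv.measurable

end SV

section RankOne

variable {n r k : ℕ}

lemma eval_secular_of_ne (a v : Fin n → ℝ) {x : ℝ} (hx : ∀ i, x ≠ a i) :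
    (secular a v).eval x = (∏ i, (x - a i)) * (1 - ∑ i, v i ^ 2 / (x - a i)) := by
  rw [eval_secular, mul_sub, mul_one, Finset.mul_sum]
  congr 1
  refine Finset.sum_congr rfl fun i _ => ?_
  have hi := sub_ne_zero.2 (hx i)
  rw [← Finset.mul_prod_erase _ _ (Finset.mem_univ i)]
  field_simp

lemma charpoly_diagonal_add_vecMulVec (a v : Fin n → ℝ) :
    (Matrix.diagonal a + Matrix.vecMulVec v v).charpoly = secular a v := by
  refine Polynomial.eq_of_infinite_eval_eq _ _ ((Set.finite_range a).infinite_compl.mono ?_)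
  intro x hx
  have hx' : ∀ i, x ≠ a i := fun i h => hx ⟨i, h.symm⟩
  have hfac : Matrix.scalar (Fin n) x - (Matrix.diagonal a + Matrix.vecMulVec v v) =
      Matrix.diagonal (fun i => x - a i) *
        (1 + Matrix.replicateCol Unit (fun i => -(v i / (x - a i))) *
          Matrix.replicateRow Unit v) := by
    ext i j
    have hi := sub_ne_zero.2 (hx' i)
    simp only [Matrix.diagonal_mul, Matrix.sub_apply, Matrix.add_apply, Matrix.scalar_apply,
      ← Matrix.vecMulVec_eq, Matrix.vecMulVec_apply, mul_add]
    rcases eq_or_ne i j with rfl | hij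
    · simp only [Matrix.diagonal_apply_eq, Matrix.one_apply_eq]
      field_simp
      ring
    · simp only [Matrix.diagonal_apply_ne _ hij, Matrix.one_apply_ne hij]
      field_simp
      ring
  rw [Set.mem_ofPred_eq, Matrix.eval_charpoly, hfac, Matrix.det_mul, Matrix.det_diagonal,
    Matrix.det_one_add_replicateCol_mul_replicateRow, eval_secular_of_ne _ _ hx', dotProduct,
    sub_eq_add_neg 1, ← Finset.sum_neg_distrib]
  congr 2
  refine Finset.sum_congr rfl fun i _ => ?_
  ring

/-- Append one entry to a vector. -/
def snoc (v : Fin n → ℝ) (x : ℝ) : Fin (n + 1) → ℝ := Fin.snoc (α := fun _ => ℝ) v x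

@[simp] lemma snoc_castSucc (v : Fin n → ℝ) (x : ℝ) (i : Fin n) : snoc v x i.castSucc = v i :=
  Fin.snoc_castSucc (α := fun _ => ℝ) x v i

@[simp] lemma snoc_last (v : Fin n → ℝ) (x : ℝ) : snoc v x (Fin.last n) = x :=
  Fin.snoc_last (α := fun _ => ℝ) x v

/-- Append the column `v` to the matrix `T`. -/
def snocCol {m : ℕ} (T : Fin m → Fin r → ℝ) (v : Fin m → ℝ) : Fin m → Fin (r + 1) → ℝ :=
  fun i => snoc (T i) (v i)

lemma snocCol_mul_transpose {m : ℕ} (T : Fin m → Fin r → ℝ) (v : Fin m → ℝ) :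
    Matrix.of (snocCol T v) * (Matrix.of (snocCol T v))ᵀ =
      Matrix.of T * (Matrix.of T)ᵀ + Matrix.vecMulVec v v := by
  ext i j
  simp [Matrix.mul_apply, Fin.sum_univ_castSucc, snocCol, Matrix.vecMulVec_apply]

lemma IsSV.exists_orthogonal {T : Fin (r + k) → Fin r → ℝ} {c : Fin r → ℝ} (h : IsSV T c) :
    ∃ Q : Matrix (Fin (r + k)) (Fin (r + k)) ℝ, Qᵀ * Q = 1 ∧ Matrix.of T * (Matrix.of T)ᵀ =
      Q * Matrix.diagonal (Fin.append (fun i => c i ^ 2) fun _ => 0) * Qᵀ := by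
  obtain ⟨κ, Q, h1, h2, h3, h4⟩ :=
    exists_orthogonal_diagonal (Matrix.posSemidef_self_mul_conjTranspose (Matrix.of T))
  rw [Matrix.conjTranspose_eq_transpose_of_trivial] at h4
  refine ⟨Q, h3, ?_⟩
  have hκ : κ = Fin.append c fun _ => 0 := by
    refine eq_of_prod_eq h1 h2 (fun i j hij => ?_) (fun i => ?_) ?_
    · induction i using Fin.addCases with
      | left i =>
        induction j using Fin.addCases with
        | left j => simpa using h.1 ((Fin.strictMono_castAdd k).le_iff_le.1 hij)
        | right j => simpa using h.2.1 i
      | right i =>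
        induction j using Fin.addCases with
        | left j =>
          rw [Fin.le_def] at hij
          simp at hij
          omega
        | right j => simp
    · induction i using Fin.addCases with
      | left i => simpa using h.2.1 i
      | right i => simp
    · have hc := Matrix.charpoly_mul_comm' (Matrix.of T) (Matrix.of T)ᵀ
      rw [h4, charpoly_orthogonal_conj h3, h.2.2] at hc
      refine mul_left_cancel₀ (pow_ne_zero r Polynomial.X_ne_zero) ?_
      rw [Fintype.card_fin, Fintype.card_fin] at hc
      rw [hc, Fin.prod_univ_add]
      simp [pow_add, mul_assoc, mul_comm]
  rw [h4, hκ]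
  congr 3
  ext i
  induction i using Fin.addCases with
  | left i => simp
  | right i => simp

/-- Polar coordinates for the last block of a vector, and absolute values for the first one. -/
noncomputable def collapse (y : Fin (r + k) → ℝ) : Fin (r + 1) → ℝ :=
  snoc (fun i => |y (Fin.castAdd k i)|) √(∑ j, y (Fin.natAdd r j) ^ 2)

lemma charpoly_snocCol {T : Fin (r + (k + 1)) → Fin r → ℝ} {c : Fin r → ℝ}
    {Q : Matrix (Fin (r + (k + 1))) (Fin (r + (k + 1))) ℝ} (hQ : Qᵀ * Q = 1)
    (hT : Matrix.of T * (Matrix.of T)ᵀ =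
      Q * Matrix.diagonal (Fin.append (fun i => c i ^ 2) fun _ => 0) * Qᵀ)
    (y : Fin (r + (k + 1)) → ℝ) :
    ((Matrix.of (snocCol T (Q *ᵥ y)))ᵀ * Matrix.of (snocCol T (Q *ᵥ y))).charpoly =
      secular (sqSnoc c) (collapse y) := by
  set d : Fin (r + (k + 1)) → ℝ := Fin.append (fun i => c i ^ 2) fun _ => 0 with hd
  set M := Matrix.of (snocCol T (Q *ᵥ y)) with hM
  have h1 : (M * Mᵀ).charpoly = secular d y := by
    have : M * Mᵀ = Q * (Matrix.diagonal d + Matrix.vecMulVec y y) * Qᵀ := by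
      rw [hM, snocCol_mul_transpose, hT, mul_add, add_mul, Matrix.mul_vecMulVec,
        Matrix.vecMulVec_mul, Matrix.vecMul_transpose]
    rw [this, Matrix.charpoly_mul_comm, ← mul_assoc, hQ, one_mul, charpoly_diagonal_add_vecMulVec]
  have h2 : secular d y = Polynomial.X ^ k * secular (sqSnoc c) (collapse y) := by
    refine Polynomial.eq_of_infinite_eval_eq _ _
      ((Set.finite_range (sqSnoc c)).infinite_compl.mono ?_)
    intro x hx
    have hx1 : ∀ i, x ≠ sqSnoc c i := fun i h => hx ⟨i, h.symm⟩
    have hx0 : x ≠ 0 := by simpa using hx1 (Fin.last r)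
    have hxd : ∀ i, x ≠ d i := fun i => by
      induction i using Fin.addCases with
      | left i => simpa [hd] using hx1 i.castSucc
      | right i => simpa [hd] using hx0
    rw [Set.mem_ofPred_eq, Polynomial.eval_mul, eval_secular_of_ne _ _ hxd,
      eval_secular_of_ne _ _ hx1, Fin.prod_univ_add, Fin.sum_univ_add,
      Fin.prod_univ_castSucc (n := r),
      Fin.sum_univ_castSucc (n := r)]
    simp only [hd, collapse, Fin.append_left, Fin.append_right, snoc_castSucc, snoc_last,
      sqSnoc_castSucc, sqSnoc_last, sub_zero, sq_abs, Finset.prod_const, Finset.card_univ,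
      Fintype.card_fin, Polynomial.eval_pow, Polynomial.eval_X]
    rw [Real.sq_sqrt (Finset.sum_nonneg fun _ _ => sq_nonneg _), ← Finset.sum_div]
    ring
  have h3 := Matrix.charpoly_mul_comm' M Mᵀ
  rw [h1, h2, Fintype.card_fin, Fintype.card_fin, ← mul_assoc, ← pow_add] at h3
  refine (mul_left_cancel₀ (pow_ne_zero (r + (k + 1)) Polynomial.X_ne_zero) ?_).symm
  rw [← h3]
  congr 2
  omega

lemma strictAnti_sqSnoc {c : Fin r → ℝ} (hc : StrictAnti c) (hc0 : ∀ i, 0 < c i) :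
    StrictAnti (sqSnoc c) := by
  intro i j hij
  induction i using Fin.lastCases with
  | last => exact absurd hij (Fin.le_last j).not_gt
  | cast i =>
    induction j using Fin.lastCases with
    | last => simpa using pow_pos (hc0 i) 2
    | cast j =>
      simpa using pow_lt_pow_left₀ (hc (Fin.castSucc_lt_castSucc_iff.1 hij)) (hc0 j).le two_ne_zero

lemma sqSnoc_nonneg (c : Fin r → ℝ) (i : Fin (r + 1)) : 0 ≤ sqSnoc c i := by
  induction i using Fin.lastCases with
  | last => simp
  | cast i => simpa using sq_nonneg (c i)

/-- A section of `collapse` on the positive orthant. -/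
def expand (k : ℕ) (w : Fin (r + 1) → ℝ) : Fin (r + (k + 1)) → ℝ :=
  Fin.append (fun i => w i.castSucc) (Fin.cons (w (Fin.last r)) fun _ => 0)

lemma collapse_expand {w : Fin (r + 1) → ℝ} (hw : ∀ i, 0 ≤ w i) :
    collapse (expand k w) = w := by
  ext i
  induction i using Fin.lastCases with
  | last => simp [collapse, expand, Fin.sum_univ_succ, Real.sqrt_sq (hw _)]
  | cast i => simp [collapse, expand, abs_of_nonneg (hw _)]

lemma collapse_nonneg (y : Fin (r + k) → ℝ) (i : Fin (r + 1)) : 0 ≤ collapse y i := by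
  induction i using Fin.lastCases with
  | last => simp [collapse]
  | cast i => simp [collapse]

lemma sv_eq_of_charpoly_eq {m m' : ℕ} {T : Fin m → Fin r → ℝ} {T' : Fin m' → Fin r → ℝ}
    (h : ((Matrix.of T)ᵀ * Matrix.of T).charpoly = ((Matrix.of T')ᵀ * Matrix.of T').charpoly) :
    sv T = sv T' :=
  IsSV.sv_eq ⟨(isSV_sv T').1, (isSV_sv T').2.1, h.trans (isSV_sv T').2.2⟩

end RankOne

section ColumnIntegral

variable {n r k : ℕ}

lemma continuous_snoc {X : Type*} [TopologicalSpace X] {f : X → Fin n → ℝ} {g : X → ℝ}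
    (hf : Continuous f) (hg : Continuous g) : Continuous fun x => snoc (f x) (g x) :=
  Continuous.finSnoc (A := fun _ => ℝ) hf hg

lemma lintegral_snoc {G : (Fin (n + 1) → ℝ) → ℝ≥0∞} (hG : Measurable G) :
    ∫⁻ u, G u = ∫⁻ v : Fin n → ℝ, ∫⁻ w : ℝ, G (snoc v w) := by
  have hs : Measurable fun p : ℝ × (Fin n → ℝ) => snoc p.2 p.1 :=
    (continuous_snoc continuous_snd continuous_fst).measurable
  have h := (volume_preserving_piFinSuccAbove (fun _ : Fin (n + 1) => ℝ) (Fin.last n)).symm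
  rw [← h.lintegral_comp hG, Measure.volume_eq_prod, lintegral_prod_symm]
  · refine lintegral_congr fun v => lintegral_congr fun w => ?_
    congr 1
    exact Fin.insertNth_last' w v
  · exact (hG.comp h.measurable).aemeasurable

lemma lintegral_append {G : (Fin (r + k) → ℝ) → ℝ≥0∞} (hG : Measurable G) :
    ∫⁻ u, G u = ∫⁻ v : Fin r → ℝ, ∫⁻ w : Fin k → ℝ, G (Fin.append v w) := by
  have h := (volume_measurePreserving_piCongrLeft (fun _ : Fin (r + k) => ℝ) finSumFinEquiv).comp
    (volume_measurePreserving_sumPiEquivProdPi_symm fun _ : Fin r ⊕ Fin k => ℝ)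
  rw [← h.lintegral_comp hG, Measure.volume_eq_prod, lintegral_prod]
  swap
  · exact (hG.comp h.measurable).aemeasurable
  refine lintegral_congr fun v => lintegral_congr fun w => ?_
  congr 1
  ext i
  induction i using Fin.addCases with
  | left i =>
    rw [Fin.append_left, ← finSumFinEquiv_apply_left]
    exact MeasurableEquiv.piCongrLeft_apply_apply (β := fun _ => ℝ) finSumFinEquiv _ (Sum.inl i)
  | right i =>
    rw [Fin.append_right, ← finSumFinEquiv_apply_right]
    exact MeasurableEquiv.piCongrLeft_apply_apply (β := fun _ => ℝ) finSumFinEquiv _ (Sum.inr i)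

lemma lintegral_orthogonal {Q : Matrix (Fin n) (Fin n) ℝ} (hQ : Qᵀ * Q = 1)
    {F : (Fin n → ℝ) → ℝ≥0∞} (hF : Measurable F) : ∫⁻ v, F v = ∫⁻ y, F (Q *ᵥ y) := by
  have hdet : Q.det * Q.det = 1 := by
    simpa using congrArg Matrix.det hQ
  have h0 : Q.det ≠ 0 := fun h => by simp [h] at hdet
  have habs : |Q.det⁻¹| = 1 := by
    rw [abs_inv, inv_eq_one, ← abs_one, ← sq_eq_sq_iff_abs_eq_abs, sq, hdet, one_pow]
  have h := Real.map_matrix_volume_pi_eq_smul_volume_pi h0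
  rw [habs, ENNReal.ofReal_one, one_smul] at h
  conv_lhs => rw [← h]
  rw [lintegral_map hF (Matrix.toLin' Q).continuous_of_finiteDimensional.measurable]
  rfl

lemma measurable_expand : Measurable (expand k : (Fin (r + 1) → ℝ) → _) := by
  refine measurable_pi_lambda _ fun i => ?_
  induction i using Fin.addCases with
  | left i =>
    simp only [expand, Fin.append_left]
    fun_prop
  | right i =>
    simp only [expand, Fin.append_right]
    induction i using Fin.cases with
    | zero =>
      simp only [Fin.cons_zero]
      fun_prop
    | succ i =>
      simp only [Fin.cons_succ]
      fun_prop

lemma continuous_snocCol {m : ℕ} :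
    Continuous fun p : (Fin m → Fin r → ℝ) × (Fin m → ℝ) => snocCol p.1 p.2 :=
  continuous_pi fun i => continuous_snoc (by fun_prop) (by fun_prop)

lemma lintegral_collapse {Φ : (Fin (r + 1) → ℝ) → ℝ≥0∞} (hΦ : Measurable Φ) :
    ∫⁻ y : Fin (r + (k + 1)) → ℝ, Φ (collapse y) =
      ENNReal.ofReal (2 ^ r * (2 * π ^ (((k : ℝ) + 1) / 2) / Real.Gamma (((k : ℝ) + 1) / 2))) *
        ∫⁻ w in orthant (r + 1), ENNReal.ofReal (w (Fin.last r) ^ k) * Φ w := by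
  set A := 2 * π ^ (((k : ℝ) + 1) / 2) / Real.Gamma (((k : ℝ) + 1) / 2) with hA
  have hA0 : 0 ≤ A := by positivity
  have hs : Measurable fun p : (Fin r → ℝ) × ℝ => snoc p.1 p.2 :=
    (continuous_snoc continuous_fst continuous_snd).measurable
  have hc : Measurable (collapse : (Fin (r + (k + 1)) → ℝ) → _) :=
    (continuous_snoc (by fun_prop) (by fun_prop)).measurable
  have hpow : Measurable fun p : (Fin r → ℝ) × ℝ =>
      ENNReal.ofReal (p.2 ^ k) * Φ (snoc p.1 p.2) :=
    (by fun_prop : Measurable fun p : (Fin r → ℝ) × ℝ => ENNReal.ofReal (p.2 ^ k)).mul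
      (hΦ.comp hs)
  have h1 : ∀ v : Fin r → ℝ, ∫⁻ z : Fin (k + 1) → ℝ, Φ (collapse (Fin.append v z)) =
      ENNReal.ofReal A * ∫⁻ w in Set.Ioi (0 : ℝ),
        ENNReal.ofReal (w ^ k) * Φ (snoc (fun i => |v i|) w) := fun v => by
    have hf : Measurable fun w => Φ (snoc (fun i => |v i|) w) :=
      hΦ.comp (continuous_snoc continuous_const continuous_id).measurable
    have := lintegral_norm_euclidean (k := k + 1) (by omega) hf
    simp only [Nat.cast_add, Nat.cast_one, Nat.add_sub_cancel] at this
    rw [hA, ← this]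
    simp only [collapse, Fin.append_left, Fin.append_right]
  have hm : Measurable fun v : Fin r → ℝ => ∫⁻ w in Set.Ioi (0 : ℝ),
      ENNReal.ofReal (w ^ k) * Φ (snoc v w) := hpow.lintegral_prod_right'
  rw [lintegral_append (G := fun y => Φ (collapse y)) (hΦ.comp hc)]
  simp_rw [h1]
  rw [lintegral_const_mul' _ _ (by simp), lintegral_comp_abs hm,
    ENNReal.ofReal_mul (by positivity), ENNReal.ofReal_pow (by norm_num), ENNReal.ofReal_ofNat,
    ← mul_assoc, mul_comm (ENNReal.ofReal A)]
  congr 1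
  rw [← lintegral_indicator measurableSet_orthant, ← lintegral_indicator measurableSet_orthant,
    lintegral_snoc]
  · refine lintegral_congr fun v => ?_
    by_cases hv : v ∈ orthant r
    · rw [Set.indicator_of_mem hv, ← lintegral_indicator measurableSet_Ioi]
      refine lintegral_congr fun w => ?_
      have hiff : snoc v w ∈ orthant (r + 1) ↔ w ∈ Set.Ioi 0 := by
        simp only [orthant, Set.mem_ofPred_eq, Fin.forall_fin_succ', snoc_castSucc, snoc_last,
          Set.mem_Ioi, and_iff_right_iff_imp]
        exact fun _ => hv
      simp only [Set.indicator, hiff, snoc_last]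
    · rw [Set.indicator_of_notMem hv]
      have hn : ∀ w, snoc v w ∉ orthant (r + 1) := fun w h =>
        hv fun i => by simpa using h i.castSucc
      simp [hn]
  · exact Measurable.indicator (by fun_prop) measurableSet_orthant

lemma weight_sqSnoc_last {c : Fin r → ℝ} (hc0 : ∀ i, 0 < c i) {κ : Fin (r + 1) → ℝ}
    (hκ0 : ∀ i, 0 < κ i) : weight (sqSnoc c) κ (Fin.last r) = (∏ j, κ j) / ∏ i, c i := by
  have h : ∏ i ∈ Finset.univ.erase (Fin.last r), (sqSnoc c i - sqSnoc c (Fin.last r)) =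
      ∏ i, c i ^ 2 := by
    rw [Fin.univ_castSuccEmb, Finset.erase_cons, Finset.prod_map]
    simp
  rw [weight, weightSq, h]
  simp only [sqSnoc_last, sub_zero]
  rw [Finset.prod_pow, Finset.prod_pow, ← div_pow, Real.sqrt_sq]
  exact div_nonneg (Finset.prod_nonneg fun i _ => (hκ0 i).le)
    (Finset.prod_nonneg fun i _ => (hc0 i).le)

lemma jacobian_sqSnoc {c : Fin r → ℝ} (hc0 : ∀ i, 0 < c i) {κ : Fin (r + 1) → ℝ}
    (hκ : κ ∈ interlacing (sqSnoc c)) :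
    ENNReal.ofReal ((∏ j, κ j) * sqVandermonde κ * (√(∏ i, ∏ j, |κ j ^ 2 - sqSnoc c i|))⁻¹) *
        ENNReal.ofReal (weight (sqSnoc c) κ (Fin.last r) ^ k) =
      ENNReal.ofReal ((∏ j, κ j) ^ k * sqVandermonde κ) *
        ENNReal.ofReal (((∏ i, c i) ^ k)⁻¹ * (√(∏ i, ∏ j, |κ j ^ 2 - c i ^ 2|))⁻¹) := by
  have hP : 0 < ∏ j, κ j := Finset.prod_pos fun j _ => hκ.1 j
  have hC : 0 < ∏ i, c i := Finset.prod_pos fun i _ => hc0 i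
  have hV : 0 ≤ sqVandermonde κ :=
    sqVandermonde_nonneg (interlacing.strictAnti hκ).antitone fun i => (hκ.1 i).le
  have hE : √(∏ i, ∏ j, |κ j ^ 2 - sqSnoc c i|) =
      √(∏ i, ∏ j, |κ j ^ 2 - c i ^ 2|) * ∏ j, κ j := by
    rw [Fin.prod_univ_castSucc, Real.sqrt_mul
      (Finset.prod_nonneg fun i _ => Finset.prod_nonneg fun j _ => abs_nonneg _)]
    simp only [sqSnoc_castSucc, sqSnoc_last, sub_zero, abs_sq]
    rw [Finset.prod_pow, Real.sqrt_sq hP.le]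
  rw [hE, weight_sqSnoc_last hc0 hκ.1]
  generalize √(∏ i, ∏ j, |κ j ^ 2 - c i ^ 2|) = E at *
  generalize (∏ j, κ j) = P at *
  generalize (∏ i, c i) = C at *
  generalize sqVandermonde κ = V at *
  rw [← ENNReal.ofReal_mul' (by positivity), ← ENNReal.ofReal_mul (by positivity)]
  congr 1
  rw [div_pow, mul_inv]
  field_simp

/-- Distribution of the singular values after appending a column to a fixed matrix. -/
lemma IsSV.lintegral_snocCol {T : Fin (r + (k + 1)) → Fin r → ℝ} {c : Fin r → ℝ} (hT : IsSV T c)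
    (hc : StrictAnti c) (hc0 : ∀ i, 0 < c i) {H : (Fin (r + 1) → ℝ) → ℝ≥0∞} (hH : Measurable H) :
    ∫⁻ v, H (sv (snocCol T v)) =
      ENNReal.ofReal (2 ^ r * (2 * π ^ (((k : ℝ) + 1) / 2) / Real.Gamma (((k : ℝ) + 1) / 2))) *
        ∫⁻ κ in interlacing (sqSnoc c),
          ENNReal.ofReal ((∏ j, κ j) ^ k * sqVandermonde κ) *
          ENNReal.ofReal (((∏ i, c i) ^ k)⁻¹ * (√(∏ i, ∏ j, |κ j ^ 2 - c i ^ 2|))⁻¹) * H κ := by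
  obtain ⟨Q, hQ, hTQ⟩ := hT.exists_orthogonal
  have ha := strictAnti_sqSnoc hc hc0
  have hcol : Measurable fun v => H (sv (snocCol T v)) :=
    hH.comp (measurable_sv.comp (continuous_snocCol.comp
      (continuous_const.prodMk continuous_id)).measurable)
  set Φ : (Fin (r + 1) → ℝ) → ℝ≥0∞ := fun w => H (sv (snocCol T (Q *ᵥ expand k w))) with hΦ
  have hΦm : Measurable Φ := by
    have hQm : Measurable fun w => Q *ᵥ w :=
      (Matrix.toLin' Q).continuous_of_finiteDimensional.measurable
    exact hcol.comp (hQm.comp measurable_expand)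
  have h1 : ∀ y, H (sv (snocCol T (Q *ᵥ y))) = Φ (collapse y) := fun y => by
    simp only [hΦ]
    congr 1
    refine sv_eq_of_charpoly_eq ?_
    rw [charpoly_snocCol hQ hTQ, charpoly_snocCol hQ hTQ, collapse_expand (collapse_nonneg y)]
  have h2 : ∀ κ ∈ interlacing (sqSnoc c), Φ (weight (sqSnoc c) κ) = H κ := fun κ hκ => by
    simp only [hΦ]
    congr 1
    refine IsSV.sv_eq ⟨(interlacing.strictAnti hκ).antitone, fun i => (hκ.1 i).le, ?_⟩
    rw [charpoly_snocCol hQ hTQ, collapse_expand (fun i => (weight_pos ha hκ i).le),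
      prod_eq_secular_weight ha hκ]
  rw [lintegral_orthogonal hQ hcol]
  simp_rw [h1]
  rw [lintegral_collapse hΦm, setLIntegral_orthant ha (sqSnoc_nonneg c)]
  congr 1
  refine setLIntegral_congr_fun (measurableSet_interlacing _) fun κ hκ => ?_
  simp only [h2 κ hκ]
  rw [← mul_assoc, jacobian_sqSnoc hc0 hκ]

end ColumnIntegral

section Main

variable {m r k : ℕ}

/-- The open Weyl chamber of strictly decreasing positive vectors. -/
def chamber (r : ℕ) : Set (Fin r → ℝ) := {κ | StrictAnti κ ∧ ∀ i, 0 < κ i}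

lemma measurableSet_chamber : MeasurableSet (chamber r) := by
  have : chamber r = (⋂ i, ⋂ j, ⋂ _ : i < j, {κ : Fin r → ℝ | κ j < κ i}) ∩ orthant r := by
    ext κ
    simp [chamber, orthant, StrictAnti]
  rw [this]
  refine MeasurableSet.inter ?_ measurableSet_orthant
  exact MeasurableSet.iInter fun i => MeasurableSet.iInter fun j => MeasurableSet.iInter fun _ =>
    measurableSet_lt (by fun_prop) (by fun_prop)

lemma measurable_sqVandermonde : Measurable (sqVandermonde : (Fin r → ℝ) → ℝ) := by
  unfold sqVandermonde
  fun_prop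

lemma continuous_sqSnoc : Continuous (sqSnoc : (Fin r → ℝ) → _) :=
  continuous_snoc (by fun_prop) continuous_const

lemma measurableSet_interlacing_sqSnoc :
    MeasurableSet {p : (Fin r → ℝ) × (Fin (r + 1) → ℝ) | p.2 ∈ interlacing (sqSnoc p.1)} := by
  have h : ∀ i, Measurable fun p : (Fin r → ℝ) × (Fin (r + 1) → ℝ) => sqSnoc p.1 i := fun i =>
    ((continuous_apply i).comp (continuous_sqSnoc.comp continuous_fst)).measurable
  have : {p : (Fin r → ℝ) × (Fin (r + 1) → ℝ) | p.2 ∈ interlacing (sqSnoc p.1)} =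
      (⋂ i, {p | 0 < p.2 i}) ∩ ((⋂ i, {p | sqSnoc p.1 i < p.2 i ^ 2}) ∩
        ⋂ i, ⋂ j, ⋂ _ : i < j, {p | p.2 j ^ 2 < sqSnoc p.1 i}) := by
    ext p
    simp [interlacing]
  rw [this]
  exact (MeasurableSet.iInter fun i => measurableSet_lt (by fun_prop) (by fun_prop)).inter
    ((MeasurableSet.iInter fun i => measurableSet_lt (h i) (by fun_prop)).inter
      (MeasurableSet.iInter fun i => MeasurableSet.iInter fun j => MeasurableSet.iInter fun _ =>
        measurableSet_lt (by fun_prop) (h i)))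

lemma chamber_and_mem_interlacing_iff {κ : Fin (r + 1) → ℝ} {c : Fin r → ℝ} :
    c ∈ chamber r ∧ κ ∈ interlacing (sqSnoc c) ↔
      (∀ i, 0 < c i) ∧ κ ∈ interlacing (sqSnoc c) := by
  refine and_congr_left fun h => ⟨fun hc => hc.2, fun hc => ⟨fun i j hij => ?_, hc⟩⟩
  refine lt_of_pow_lt_pow_left₀ 2 (hc i).le ?_
  have h1 := h.2.1 j.castSucc
  have h2 := h.2.2 i.castSucc j.castSucc (Fin.castSucc_lt_castSucc_iff.2 hij)
  rw [sqSnoc_castSucc] at h1 h2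
  exact h1.trans h2

lemma lintegral_eq_lintegral_snocCol {F : (Fin m → Fin (r + 1) → ℝ) → ℝ≥0∞} (hF : Measurable F) :
    ∫⁻ M, F M = ∫⁻ T : Fin m → Fin r → ℝ, ∫⁻ v : Fin m → ℝ, F (snocCol T v) := by
  have h1 := (volume_measurePreserving_arrowProdEquivProdArrow ℝ (Fin r → ℝ) (Fin m)).symm
  have h2 : MeasurePreserving
      (fun (a : Fin m → ℝ × (Fin r → ℝ)) i =>
        (MeasurableEquiv.piFinSuccAbove (fun _ : Fin (r + 1) => ℝ) (Fin.last r)).symm (a i))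
      volume volume :=
    volume_preserving_pi fun _ =>
      (volume_preserving_piFinSuccAbove (fun _ : Fin (r + 1) => ℝ) (Fin.last r)).symm
  have h := h2.comp h1
  rw [← h.lintegral_comp hF, Measure.volume_eq_prod, lintegral_prod_symm]
  · refine lintegral_congr fun T => lintegral_congr fun v => ?_
    congr 1
    ext1 i
    exact Fin.insertNth_last' (v i) (T i)
  · exact (hF.comp h.measurable).aemeasurable

/-- The normalizing constant in the law of the singular values. -/
noncomputable def svConst (m r : ℕ) : ℝ :=
  2 ^ r * π ^ ((r : ℝ) * ((m : ℝ) + r) / 2) / (mvGamma r ((r : ℝ) / 2) * mvGamma r ((m : ℝ) / 2))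

lemma svConst_zero (m : ℕ) : svConst m 0 = 1 := by
  simp [svConst, mvGamma]

lemma mvGamma_succ (p : ℕ) (a : ℝ) :
    mvGamma (p + 1) a = π ^ ((p : ℝ) / 2) * Real.Gamma (a - p / 2) * mvGamma p a := by
  rw [mvGamma, mvGamma, Finset.prod_range_succ,
    show ((p + 1 : ℕ) : ℝ) * (((p + 1 : ℕ) : ℝ) - 1) / 4 = p / 2 + p * (p - 1) / 4 by
      push_cast; ring, Real.rpow_add Real.pi_pos]
  ring

lemma mvGamma_succ' (p : ℕ) (a : ℝ) :
    mvGamma (p + 1) a = π ^ ((p : ℝ) / 2) * Real.Gamma a * mvGamma p (a - 1 / 2) := by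
  rw [mvGamma, mvGamma, Finset.prod_range_succ',
    show ((p + 1 : ℕ) : ℝ) * (((p + 1 : ℕ) : ℝ) - 1) / 4 = p / 2 + p * (p - 1) / 4 by
      push_cast; ring, Real.rpow_add Real.pi_pos]
  have : ∀ i : ℕ, a - ((i + 1 : ℕ) : ℝ) / 2 = a - 1 / 2 - i / 2 := fun i => by push_cast; ring
  simp_rw [this]
  simp only [Nat.cast_zero, zero_div, sub_zero]
  ring

lemma mvGamma_pos {p : ℕ} {a : ℝ} (h : (p : ℝ) / 2 ≤ a) : 0 < mvGamma p a := by
  refine mul_pos (by positivity) (Finset.prod_pos fun i hi => Real.Gamma_pos_of_pos ?_)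
  have : (i : ℝ) < p := by exact_mod_cast Finset.mem_range.1 hi
  linarith

lemma svConst_nonneg (h : r ≤ m) : 0 ≤ svConst m r := by
  have h1 := mvGamma_pos (p := r) le_rfl
  have h2 := mvGamma_pos (p := r) (a := (m : ℝ) / 2) (by gcongr)
  rw [svConst]
  positivity

lemma svConst_succ (r k : ℕ) :
    svConst (r + (k + 1)) r *
      (2 ^ r * (2 * π ^ (((k : ℝ) + 1) / 2) / Real.Gamma (((k : ℝ) + 1) / 2))) *
      (π ^ (((r : ℝ) + 1) / 2) / Real.Gamma (((r : ℝ) + 1) / 2) / 2 ^ r) =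
    svConst (r + (k + 1)) (r + 1) := by
  have h1 := (mvGamma_pos (p := r) le_rfl).ne'
  have h2 := (mvGamma_pos (p := r) (a := ((r + (k + 1) : ℕ) : ℝ) / 2)
    (by gcongr; omega)).ne'
  have h3 : Real.Gamma (((k : ℝ) + 1) / 2) ≠ 0 := (Real.Gamma_pos_of_pos (by positivity)).ne'
  have h4 : Real.Gamma (((r : ℝ) + 1) / 2) ≠ 0 := (Real.Gamma_pos_of_pos (by positivity)).ne'
  rw [svConst, svConst, mvGamma_succ r (((r + (k + 1) : ℕ) : ℝ) / 2), mvGamma_succ']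
  have e1 : ((r + (k + 1) : ℕ) : ℝ) / 2 - r / 2 = ((k : ℝ) + 1) / 2 := by push_cast; ring
  have e2 : ((r + 1 : ℕ) : ℝ) / 2 - 1 / 2 = (r : ℝ) / 2 := by push_cast; ring
  have e3 : ((r + 1 : ℕ) : ℝ) / 2 = ((r : ℝ) + 1) / 2 := by push_cast; ring
  have e4 : ((r + 1 : ℕ) : ℝ) * (((r + (k + 1) : ℕ) : ℝ) + ((r + 1 : ℕ) : ℝ)) / 2 =
      (r : ℝ) * (((r + (k + 1) : ℕ) : ℝ) + r) / 2 + ((k : ℝ) + 1) / 2 + ((r : ℝ) + 1) / 2 +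
        (r : ℝ) / 2 + (r : ℝ) / 2 := by push_cast; ring
  rw [e1, e2, e3, e4, Real.rpow_add Real.pi_pos, Real.rpow_add Real.pi_pos,
    Real.rpow_add Real.pi_pos, Real.rpow_add Real.pi_pos]
  have h5 : π ^ ((r : ℝ) / 2) ≠ 0 := by positivity
  generalize π ^ ((r : ℝ) / 2) = p at *
  generalize mvGamma r ((r : ℝ) / 2) = g1 at *
  generalize mvGamma r (((r + (k + 1) : ℕ) : ℝ) / 2) = g2 at *
  field_simp
  ring

/-- The pairs `(c, κ)` of strictly interlacing singular values before and after appending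
a column. -/
def interlacingPairs (r : ℕ) : Set ((Fin r → ℝ) × (Fin (r + 1) → ℝ)) :=
  {p | p.1 ∈ chamber r ∧ p.2 ∈ interlacing (sqSnoc p.1)}

lemma measurableSet_interlacingPairs : MeasurableSet (interlacingPairs r) :=
  (measurable_fst measurableSet_chamber).inter measurableSet_interlacing_sqSnoc

/-- Integrating out the smaller vector of singular values. -/
lemma lintegral_interlacingPairs_fst (H : (Fin (r + 1) → ℝ) → ℝ≥0∞)
    (κ : Fin (r + 1) → ℝ) :
    ∫⁻ c, (interlacingPairs r).indicator (fun p => ENNReal.ofReal ((∏ i, p.1 i) ^ (k + 1) *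
        sqVandermonde p.1) * (ENNReal.ofReal ((∏ j, p.2 j) ^ k * sqVandermonde p.2) *
          ENNReal.ofReal (((∏ i, p.1 i) ^ k)⁻¹ * (√(∏ i, ∏ j, |p.2 j ^ 2 - p.1 i ^ 2|))⁻¹) * H p.2))
        (c, κ) =
      ENNReal.ofReal (π ^ (((r : ℝ) + 1) / 2) / Real.Gamma (((r : ℝ) + 1) / 2) / 2 ^ r) *
        (chamber (r + 1)).indicator
          (fun κ => ENNReal.ofReal ((∏ j, κ j) ^ k * sqVandermonde κ) * H κ) κ := by
  by_cases hκ : κ ∈ chamber (r + 1)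
  · rw [Set.indicator_of_mem hκ, ← lintegral_dixonAnderson hκ.1 hκ.2]
    set S := {c : Fin r → ℝ | (∀ i, 0 < c i) ∧ κ ∈ interlacing (sqSnoc c)} with hS
    have hset : MeasurableSet S := by
      simp_rw [hS, ← chamber_and_mem_interlacing_iff]
      exact measurableSet_interlacingPairs.preimage measurable_prodMk_right
    rw [← lintegral_indicator hset, ← lintegral_mul_const]
    · refine lintegral_congr fun c => ?_
      by_cases hc : c ∈ S
      · have hc' := chamber_and_mem_interlacing_iff.2 hc
        rw [Set.indicator_of_mem (show (c, κ) ∈ interlacingPairs r from hc'),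
          Set.indicator_of_mem hc]
        have hprod : 0 < ∏ i, c i := Finset.prod_pos fun i _ => hc.1 i
        have hV := sqVandermonde_nonneg hc'.1.1.antitone fun i => (hc.1 i).le
        have : (∏ i, c i) * sqVandermonde c * (√(∏ i, ∏ j, |κ j ^ 2 - c i ^ 2|))⁻¹ =
            ((∏ i, c i) ^ (k + 1) * sqVandermonde c) *
              (((∏ i, c i) ^ k)⁻¹ * (√(∏ i, ∏ j, |κ j ^ 2 - c i ^ 2|))⁻¹) := by
          generalize (√(∏ i, ∏ j, |κ j ^ 2 - c i ^ 2|))⁻¹ = e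
          generalize ∏ i, c i = p at hprod
          field_simp
          ring
        rw [this, ENNReal.ofReal_mul (p := (∏ i, c i) ^ (k + 1) * sqVandermonde c) (by positivity)]
        simp only [mul_assoc, mul_left_comm]
      · rw [Set.indicator_of_notMem hc, zero_mul, Set.indicator_of_notMem]
        exact fun h => hc (chamber_and_mem_interlacing_iff.1 h)
    · refine Measurable.indicator ?_ hset
      have := measurable_sqVandermonde (r := r)
      fun_prop
  · rw [Set.indicator_of_notMem hκ, mul_zero]
    refine (lintegral_congr fun c => Set.indicator_of_notMem (fun h => hκ ?_) _).trans
      lintegral_zero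
    exact ⟨interlacing.strictAnti h.2, h.2.1⟩

/-- The law of the singular values of a matrix under Lebesgue measure. -/
theorem lintegral_sv {m r : ℕ} (hrm : r ≤ m) {H : (Fin r → ℝ) → ℝ≥0∞} (hH : Measurable H) :
    ∫⁻ T : Fin m → Fin r → ℝ, H (sv T) = ENNReal.ofReal (svConst m r) *
      ∫⁻ κ in chamber r, ENNReal.ofReal ((∏ i, κ i) ^ (m - r) * sqVandermonde κ) * H κ := by
  induction r with
  | zero =>
    have h1 : (volume : Measure (Fin m → Fin 0 → ℝ)) Set.univ = 1 := by
      rw [volume_pi, Measure.pi_univ]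
      simp [volume_pi]
    have h2 : chamber 0 = Set.univ := by
      ext κ
      simp [chamber, Subsingleton.strictAnti]
    have h3 : (volume : Measure (Fin 0 → ℝ)) Set.univ = 1 := by
      simp [volume_pi]
    rw [h2, Measure.restrict_univ, lintegral_unique, lintegral_unique, h1, h3, svConst_zero]
    simpa [sqVandermonde] using congrArg H (Subsingleton.elim _ _)
  | succ r ih =>
    obtain ⟨k, rfl⟩ : ∃ k, m = r + (k + 1) := ⟨m - (r + 1), by omega⟩
    have hae : ∀ᵐ T : Fin (r + (k + 1)) → Fin r → ℝ, sv T ∈ chamber r := by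
      have h := ih (by omega) (H := (chamber r)ᶜ.indicator 1)
        (measurable_one.indicator measurableSet_chamber.compl)
      rw [setLIntegral_congr_fun measurableSet_chamber (g := 0) fun κ hκ => by simp [hκ]] at h
      simp only [Pi.zero_apply, lintegral_zero, mul_zero] at h
      rw [lintegral_eq_zero_iff (f := fun T => (chamber r)ᶜ.indicator 1 (sv T))
        ((measurable_one.indicator measurableSet_chamber.compl).comp measurable_sv)] at h
      filter_upwards [h] with T hT
      by_contra hn
      simp [hn] at hT
    set K : ℝ := 2 ^ r * (2 * π ^ (((k : ℝ) + 1) / 2) / Real.Gamma (((k : ℝ) + 1) / 2)) with hK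
    set B : (Fin r → ℝ) × (Fin (r + 1) → ℝ) → ℝ≥0∞ := fun p =>
      ENNReal.ofReal ((∏ j, p.2 j) ^ k * sqVandermonde p.2) *
        ENNReal.ofReal (((∏ i, p.1 i) ^ k)⁻¹ * (√(∏ i, ∏ j, |p.2 j ^ 2 - p.1 i ^ 2|))⁻¹) * H p.2
      with hB
    have hV := measurable_sqVandermonde (r := r)
    have hV' := measurable_sqVandermonde (r := r + 1)
    have hBm : Measurable B := by
      simp only [hB]
      fun_prop
    have hBi := hBm.indicator (measurableSet_interlacingPairs (r := r))
    set Ψ : (Fin r → ℝ) → ℝ≥0∞ := fun c => ENNReal.ofReal K *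
      ∫⁻ κ, (interlacingPairs r).indicator B (c, κ) with hΨ
    have hΨm : Measurable Ψ := (hBi.lintegral_prod_right').const_mul _
    have hstep : ∀ᵐ T : Fin (r + (k + 1)) → Fin r → ℝ,
        ∫⁻ v, H (sv (snocCol T v)) = Ψ (sv T) := by
      filter_upwards [hae] with T hT
      rw [(isSV_sv T).lintegral_snocCol hT.1 hT.2 hH, ← lintegral_indicator
        (show MeasurableSet (interlacing (sqSnoc (sv T))) from
          measurableSet_interlacing_sqSnoc.preimage measurable_prodMk_left)]
      simp only [hΨ, hK]
      congr 1
      refine lintegral_congr fun κ => ?_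
      by_cases h : κ ∈ interlacing (sqSnoc (sv T))
      · rw [Set.indicator_of_mem (show (sv T, κ) ∈ interlacingPairs r from ⟨hT, h⟩),
          Set.indicator_of_mem (by exact h)]
      · rw [Set.indicator_of_notMem (by exact h), Set.indicator_of_notMem]
        exact fun h' => h h'.2
    rw [lintegral_eq_lintegral_snocCol (F := fun M => H (sv M)) (hH.comp measurable_sv),
      lintegral_congr_ae hstep,
      ih (by omega) hΨm, ← svConst_succ, ← lintegral_indicator measurableSet_chamber,
      ← lintegral_indicator measurableSet_chamber, Nat.add_sub_cancel_left,
      show r + (k + 1) - (r + 1) = k by omega]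
    have hA : Measurable fun c : Fin r → ℝ =>
      ENNReal.ofReal ((∏ i, c i) ^ (k + 1) * sqVandermonde c) := by fun_prop
    have hF : Measurable ((interlacingPairs r).indicator fun p =>
        ENNReal.ofReal ((∏ i, p.1 i) ^ (k + 1) * sqVandermonde p.1) * B p) :=
      ((hA.comp measurable_fst).mul hBm).indicator measurableSet_interlacingPairs
    have hfst : ∀ c, (chamber r).indicator (fun c => ENNReal.ofReal ((∏ i, c i) ^ (k + 1) *
          sqVandermonde c) * Ψ c) c = ENNReal.ofReal K * ∫⁻ κ, (interlacingPairs r).indicator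
        (fun p => ENNReal.ofReal ((∏ i, p.1 i) ^ (k + 1) * sqVandermonde p.1) * B p) (c, κ) := by
      intro c
      by_cases hc : c ∈ chamber r
      · rw [Set.indicator_of_mem hc, hΨ, mul_left_comm, ← lintegral_const_mul _
          (show Measurable fun κ => (interlacingPairs r).indicator B (c, κ) from
            hBi.comp measurable_prodMk_left)]
        classical simp only [Set.indicator_apply, mul_ite, mul_zero]
      · rw [Set.indicator_of_notMem hc, (lintegral_congr fun κ =>
          Set.indicator_of_notMem (fun h => hc h.1) _).trans lintegral_zero, mul_zero]
    simp_rw [hfst]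
    rw [lintegral_const_mul _ hF.lintegral_prod_right', lintegral_lintegral_swap
      (f := fun c κ => (interlacingPairs r).indicator (fun p =>
        ENNReal.ofReal ((∏ i, p.1 i) ^ (k + 1) * sqVandermonde p.1) * B p) (c, κ)) hF.aemeasurable]
    simp only [hB]
    simp_rw [lintegral_interlacingPairs_fst]
    rw [lintegral_const_mul _ (Measurable.indicator (by fun_prop) measurableSet_chamber),
      ENNReal.ofReal_mul (mul_nonneg (svConst_nonneg (by omega)) (by positivity)),
      ENNReal.ofReal_mul (svConst_nonneg (by omega))]
    simp only [mul_assoc, hK]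

end Main

section Density

variable {m r : ℕ}

lemma det_one_add_mul_transpose (T : Fin m → Fin r → ℝ) :
    ((1 : Matrix (Fin m) (Fin m) ℝ) + Matrix.of T * (Matrix.of T)ᵀ).det =
      ∏ i, (1 + sv T i ^ 2) := by
  have h : (1 : Matrix (Fin r) (Fin r) ℝ) + (Matrix.of T)ᵀ * Matrix.of T =
      -(Matrix.scalar (Fin r) (-1) - (Matrix.of T)ᵀ * Matrix.of T) := by
    rw [map_neg, map_one]
    abel
  rw [Matrix.det_one_add_mul_comm, h, Matrix.det_neg, det_sub_eq_prod_sv, ← Finset.card_univ,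
    ← Finset.prod_const, ← Finset.prod_mul_distrib]
  exact Finset.prod_congr rfl fun i _ => by ring

end Density
end SingularValues
/-- Pushforward of the measure with density `det(I_m + TTᵀ)^{-(n+r)/2}` under the
singular-value map `σ` (σ T is the decreasing vector of singular values of `T`, i.e. a
nonnegative decreasing vector whose squares are the eigenvalues of `TᵀT`): it equals
`(2^r π^{r(m+r)/2} / (Γ_r[r/2] Γ_r[m/2]))` times the measure with density
`1{κ₁ > ⋯ > κ_r > 0} ∏ κ_i^{m-r}(1+κ_i²)^{-(n+r)/2} ∏_{i<j}(κ_i² - κ_j²)`. -/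
theorem pushforward_t_singular_values (m n r : ℕ) (hr : 1 ≤ r) (hrn : r ≤ n) (hnm : n ≤ m)
    (σ : (Fin m → Fin r → ℝ) → (Fin r → ℝ))
    (hσ : ∀ T : Fin m → Fin r → ℝ, Antitone (σ T) ∧ (∀ i, 0 ≤ σ T i) ∧
      ∃ P : Matrix (Fin r) (Fin r) ℝ, Pᵀ * P = 1 ∧
        (Matrix.of T)ᵀ * Matrix.of T = P * Matrix.diagonal (fun i => σ T i ^ 2) * Pᵀ) :
    (volume.withDensity fun T : Fin m → Fin r → ℝ =>
        ENNReal.ofReal (((1 : Matrix (Fin m) (Fin m) ℝ) +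
          Matrix.of T * (Matrix.of T)ᵀ).det ^ (-(((n : ℝ) + r) / 2)))).map σ
      = ENNReal.ofReal (2 ^ r * Real.pi ^ ((r : ℝ) * ((m : ℝ) + r) / 2)
            / (mvGamma r ((r : ℝ) / 2) * mvGamma r ((m : ℝ) / 2))) •
          volume.withDensity (fun κ : Fin r → ℝ =>
            ENNReal.ofReal
              (Set.indicator {κ : Fin r → ℝ | StrictAnti κ ∧ ∀ i, 0 < κ i}
                (fun κ => (∏ i, κ i ^ (m - r) * (1 + κ i ^ 2) ^ (-(((n : ℝ) + r) / 2))) *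
                  ∏ i, ∏ j ∈ Finset.Ioi i, (κ i ^ 2 - κ j ^ 2)) κ)) := by
  have hσ' : σ = SingularValues.sv := funext fun T => by
    obtain ⟨h1, h2, P, hP, h3⟩ := hσ T
    exact (SingularValues.IsSV.sv_eq
      ⟨h1, h2, by rw [h3, SingularValues.charpoly_orthogonal_conj hP]⟩).symm
  rw [hσ']
  ext A hA
  have hsv := SingularValues.measurable_sv (m := m) (r := r)
  set f : (Fin r → ℝ) → ℝ≥0∞ :=
    fun κ => ENNReal.ofReal ((∏ i, (1 + κ i ^ 2)) ^ (-(((n : ℝ) + r) / 2))) with hf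
  have hfm : Measurable f := by fun_prop
  rw [Measure.map_apply hsv hA, withDensity_apply _ (hsv hA), Measure.smul_apply,
    withDensity_apply _ hA, smul_eq_mul, ← lintegral_indicator (hsv hA), ← lintegral_indicator hA]
  simp_rw [SingularValues.det_one_add_mul_transpose]
  have h := SingularValues.lintegral_sv (hrn.trans hnm) (hfm.indicator hA)
  refine Eq.trans ?_ (h.trans ?_)
  · rfl
  rw [← lintegral_indicator SingularValues.measurableSet_chamber]
  refine congrArg _ (lintegral_congr fun κ => ?_)
  by_cases hκ : κ ∈ SingularValues.chamber r
  · by_cases hκA : κ ∈ A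
    · rw [Set.indicator_of_mem hκ, Set.indicator_of_mem hκA, Set.indicator_of_mem hκA,
        Set.indicator_of_mem (by exact hκ), hf, ← ENNReal.ofReal_mul, Finset.prod_mul_distrib,
        Finset.prod_pow, Real.finsetProd_rpow _ _ fun i _ => by positivity,
        SingularValues.sqVandermonde]
      · congr 1
        ring
      · exact mul_nonneg (pow_nonneg (Finset.prod_nonneg fun i _ => (hκ.2 i).le) _)
          (SingularValues.sqVandermonde_nonneg hκ.1.antitone fun i => (hκ.2 i).le)
    · rw [Set.indicator_of_mem hκ, Set.indicator_of_notMem hκA, Set.indicator_of_notMem hκA,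
        mul_zero]
  · rw [Set.indicator_of_notMem hκ]
    by_cases hκA : κ ∈ A
    · rw [Set.indicator_of_mem hκA, Set.indicator_of_notMem (by exact hκ), ENNReal.ofReal_zero]
    · rw [Set.indicator_of_notMem hκA]
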